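/- For Lebesgue-almost every x ∈ (0,1), the limit lim_{N→∞} (2 log Q_N(x))/N exists and equals ∫₀¹ log f dμ, where Q_N(x) is the denominator of the N-th SCF convergent of x and f is the explicit piecewise function defined from T. -/

import Mathlib

open MeasureTheory Real Set Filter Topology

namespace SCF

/-- The involution `ι(x) = (1−x)/(1+x)`. -/
noncomputable def iota (x : ℝ) : ℝ := (1 - x) / (1 + x)

/-- Even continued-fraction step.  For `y ∈ (0,1/2]` one has
`⌊(1/y+1)/2⌋ = k` whenever `1/y ∈ (2k−1, 2k+1)`, so `Te y = |1/y − 2k|`;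
explicitly `Te y = 1/y − 2` on `[1/3,1/2]`, `Te y = 1/y − 2k` on
`[1/(2k+1), 1/(2k))` and `Te y = 2k − 1/y` on `[1/(2k), 1/(2k−1))` (`k ≥ 2`). -/
noncomputable def Te (y : ℝ) : ℝ := |1 / y - 2 * (⌊(1 / y + 1) / 2⌋ : ℝ)|

/-- The spliced continued fraction (SCF) map `T : [0,1] → [0,1]`, with
`T 0 = 0`, `T 1 = 1`.  On `(0,1/2]` it is the even continued fraction map
(see `Te`), and on `(1/2,1)` it is the odd–odd map, which is the conjugate
`ι ∘ Te ∘ ι` of the even map; this agrees with the branchwise definition: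
`T x = (k x − (k−1))/(k − (k+1) x)` on `((k−1)/k, (2k−1)/(2k+1)]` and
`T x = (k − (k+1) x)/(k x − (k−1))` on `((2k−1)/(2k+1), k/(k+1)]` for `k ≥ 2`. -/
noncomputable def T (x : ℝ) : ℝ :=
  if x ≤ 0 then 0
  else if 1 ≤ x then 1
  else if x ≤ 1 / 2 then Te x
  else iota (Te (iota x))

/-- Parity label of a digit: `e` (even cusp) or `o` (odd–odd cusp). -/
inductive Par | e | o
deriving DecidableEq

/-- A candidate SCF digit `(a, ε)_s`. -/
structure Digit where
  a : ℤ
  eps : ℤ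
  s : Par
deriving DecidableEq

/-- The digit set `𝒜 = {(k,ε)_s : k ≥ 2, ε = ±1, s ∈ {e,o}} ∪ {(1,+1)_e}`. -/
def Digit.Valid (d : Digit) : Prop :=
  (2 ≤ d.a ∧ (d.eps = 1 ∨ d.eps = -1)) ∨ (d.a = 1 ∧ d.eps = 1 ∧ d.s = Par.e)

/-- The branch intervals `I_{(a,ε)_s}` of the SCF map. -/
noncomputable def branch (d : Digit) : Set ℝ :=
  match d.s with
  | Par.e =>
      if d.a = 1 then Set.Icc (1/3 : ℝ) (1/2)
      else if d.eps = 1 then Set.Ico (1 / (2 * (d.a : ℝ) + 1)) (1 / (2 * (d.a : ℝ)))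
      else Set.Ico (1 / (2 * (d.a : ℝ))) (1 / (2 * (d.a : ℝ) - 1))
  | Par.o =>
      if d.eps = 1 then
        Set.Ioc ((2 * (d.a : ℝ) - 1) / (2 * (d.a : ℝ) + 1)) ((d.a : ℝ) / ((d.a : ℝ) + 1))
      else
        Set.Ioc (((d.a : ℝ) - 1) / (d.a : ℝ)) ((2 * (d.a : ℝ) - 1) / (2 * (d.a : ℝ) + 1))

open Classical in
/-- The SCF digit of a point `y` (the unique valid digit `d` with `y ∈ I_d`;
well defined for every `y ∈ (0,1)`). -/
noncomputable def digit (y : ℝ) : Digit :=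
  if h : ∃ d : Digit, d.Valid ∧ y ∈ branch d then h.choose else ⟨1, 1, Par.e⟩

/-- The `n`-th SCF digit `(a_n(x), ε_n(x))_{s_n(x)}` of `x`, `n ≥ 1`,
determined by `T^[n−1] x ∈ I_{(a_n,ε_n)_{s_n}}`. -/
noncomputable def dig (n : ℕ) (x : ℝ) : Digit := digit (T^[n - 1] x)

/-- The `n`-th SCF partial quotient `a_n(x)`. -/
noncomputable def a (n : ℕ) (x : ℝ) : ℤ := (dig n x).a

/-- The invariant density `f_μ`. -/
noncomputable def fdens (x : ℝ) : ℝ :=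
  2 / (Real.log (2 + Real.sqrt 3) * (1 - (2 - Real.sqrt 3) * x) * (1 + Real.sqrt 3 * x))

/-- The absolutely continuous `T`-invariant probability measure `μ` on `(0,1)`. -/
noncomputable def mu : Measure ℝ :=
  (volume.restrict (Set.Ioo (0 : ℝ) 1)).withDensity fun x => ENNReal.ofReal (fdens x)

/-- The inverse branches `h_{(a,ε)_s}` of the SCF map `T`. -/
noncomputable def h (d : Digit) (x : ℝ) : ℝ :=
  match d.s with
  | Par.e => 1 / (2 * (d.a : ℝ) + (d.eps : ℝ) * x)
  | Par.o =>
      if d.eps = 1 then (((d.a : ℝ) - 1) * x + (d.a : ℝ)) / ((d.a : ℝ) * x + ((d.a : ℝ) + 1))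
      else ((d.a : ℝ) * x + ((d.a : ℝ) - 1)) / (((d.a : ℝ) + 1) * x + (d.a : ℝ))

/-- Composed inverse branch `h_{A^{(n)}} = h_{A₁} ∘ ⋯ ∘ h_{A_n}` of a word. -/
noncomputable def hWord (l : List Digit) : ℝ → ℝ :=
  l.foldr (fun d g => h d ∘ g) id

/-- The dual inverse branches `bar h_{(b,η)_t}`. -/
noncomputable def hbar (d : Digit) (y : ℝ) : ℝ :=
  match d.s with
  | Par.e => (d.eps : ℝ) / (2 * (d.a : ℝ) + y)
  | Par.o =>
      1 / (1 + (d.eps : ℝ) / (((d.a : ℝ) - ((max 0 d.eps : ℤ) : ℝ)) + 1 / (1 + y)))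

/-- The matrix `M_{(a,ε)_s}` associated with the inverse branch `h_{(a,ε)_s}`. -/
noncomputable def Mdig (d : Digit) : Matrix (Fin 2) (Fin 2) ℝ :=
  match d.s with
  | Par.e => !![0, 1; (d.eps : ℝ), 2 * (d.a : ℝ)]
  | Par.o =>
      !![(d.a : ℝ) - ((max 0 d.eps : ℤ) : ℝ), (d.a : ℝ) - ((max 0 d.eps : ℤ) : ℝ) + (d.eps : ℝ);
         (d.a : ℝ) - ((max 0 d.eps : ℤ) : ℝ) + 1, (d.a : ℝ) - ((max 0 d.eps : ℤ) : ℝ) + (d.eps : ℝ) + 1]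

/-- `M_n(x) = M_{(a₁,ε₁)_{s₁}} ⋯ M_{(a_n,ε_n)_{s_n}}`. -/
noncomputable def Mn (n : ℕ) (x : ℝ) : Matrix (Fin 2) (Fin 2) ℝ :=
  ((List.range n).map fun i => Mdig (digit (T^[i] x))).prod

/-- `P_n(x)`: the `(1,2)`-entry of `M_n(x)` (numerator of the `n`-th convergent). -/
noncomputable def Pc (n : ℕ) (x : ℝ) : ℝ := Mn n x 0 1

/-- `Q_n(x)`: the `(2,2)`-entry of `M_n(x)` (denominator of the `n`-th convergent). -/
noncomputable def Qc (n : ℕ) (x : ℝ) : ℝ := Mn n x 1 1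


/-- The piecewise function `f` from Theorem 3.12 of the paper. -/
noncomputable def fPiece (x : ℝ) : ℝ :=
  if x ≤ 1/2 then
    (if T x ≤ 1/2 then 1 / (T x) ^ 2 else 2 / (1 - T x) ^ 2)
  else
    (if T x ≤ 1/2 then (1 + T x) ^ 2 / (2 * (T x) ^ 2) else (1 + T x) ^ 2 / (1 - T x) ^ 2)

/-- Running maxima of Birkhoff sums: `Mx T f n = max_{1 ≤ k ≤ n+1} S_k f`. -/
noncomputable def Mx {Ω : Type*} (T : Ω → Ω) (f : Ω → ℝ) : ℕ → Ω → ℝ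
  | 0 => f
  | n + 1 => fun x => f x + max 0 (Mx T f n (T x))

lemma Mx_mono {Ω : Type*} (T : Ω → Ω) (f : Ω → ℝ) (n : ℕ) (x : Ω) :
    Mx T f n x ≤ Mx T f (n + 1) x := by
  induction n generalizing x with
  | zero => simp [Mx]
  | succ n ih =>
    have := ih (T x)
    simp only [Mx] at this ⊢
    gcongr

lemma sum_le_Mx {Ω : Type*} (T : Ω → Ω) (f : Ω → ℝ) (n : ℕ) (x : Ω) :
    birkhoffSum T f (n + 1) x ≤ Mx T f n x := by
  induction n generalizing x with
  | zero => simp [Mx]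
  | succ n ih =>
    rw [birkhoffSum_succ']
    have := ih (T x)
    simp only [Mx]
    gcongr
    exact this.trans (le_max_right _ _)

lemma Mx_measurable {Ω : Type*} [MeasurableSpace Ω] {T : Ω → Ω} {f : Ω → ℝ}
    (hT : Measurable T) (hf : Measurable f) (n : ℕ) : Measurable (Mx T f n) := by
  induction n with
  | zero => exact hf
  | succ n ih => exact hf.add (measurable_const.max (ih.comp hT))

lemma Mx_integrable {Ω : Type*} [MeasurableSpace Ω] {μ : Measure Ω} {T : Ω → Ω} {f : Ω → ℝ}
    (hT : MeasurePreserving T μ μ) (hf : Integrable f μ) (n : ℕ) : Integrable (Mx T f n) μ := by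
  induction n with
  | zero => exact hf
  | succ n ih =>
    have h1 : Integrable (fun x => Mx T f n (T x)) μ := hT.integrable_comp_of_integrable ih
    have h2 : Integrable (fun x => max 0 (Mx T f n (T x))) μ := by
      have := h1.pos_part
      simpa [max_comm] using this
    exact hf.add h2

/-- If an integrable function has negative mean, its Birkhoff sums are a.e. bounded above. -/
lemma birkhoff_bdd {Ω : Type*} [MeasurableSpace Ω] {μ : Measure Ω} [IsProbabilityMeasure μ]
    {T : Ω → Ω} {f : Ω → ℝ} (hT : Ergodic T μ) (hm : Measurable f) (hf : Integrable f μ)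
    (hneg : ∫ x, f x ∂μ < 0) :
    ∀ᵐ x ∂μ, BddAbove (range fun n => Mx T f n x) := by
  have hmono : ∀ x, Monotone fun n => Mx T f n x :=
    fun x => monotone_nat_of_le_succ fun n => Mx_mono T f n x
  set B : Set Ω := {x | BddAbove (range fun n => Mx T f n x)} with hB
  have hBm : MeasurableSet B :=
    measurableSet_bddAbove_range fun n => Mx_measurable hT.measurable hm n
  have hinv : T ⁻¹' B = B := by
    ext x
    simp only [hB, mem_preimage, mem_ofPred_eq]
    constructor
    · rintro ⟨C, hC⟩
      refine ⟨f x + max 0 C, ?_⟩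
      rintro _ ⟨n, rfl⟩
      refine (Mx_mono T f n x).trans ?_
      simp only [Mx]
      gcongr
      exact hC ⟨n, rfl⟩
    · rintro ⟨C, hC⟩
      refine ⟨C - f x, ?_⟩
      rintro _ ⟨n, rfl⟩
      have h1 : Mx T f (n + 1) x ≤ C := hC ⟨n + 1, rfl⟩
      simp only [Mx] at h1
      have := le_max_right 0 (Mx T f n (T x))
      show Mx T f n (T x) ≤ C - f x
      linarith
  rcases hT.toPreErgodic.ae_empty_or_univ hBm hinv with h | h
  · exfalso
    have hae : ∀ᵐ x ∂μ, ¬ BddAbove (range fun n => Mx T f n x) := by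
      filter_upwards [h] with x hx hx'
      have : x ∈ B := hx'
      have h2 : (x ∈ B) = (x ∈ (∅ : Set Ω)) := hx
      rw [h2] at this
      exact this
    have hae' : ∀ᵐ x ∂μ, ¬ BddAbove (range fun n => Mx T f n (T x)) :=
      hT.quasiMeasurePreserving.ae hae
    have hlim : Tendsto (fun n => ∫ x, (Mx T f (n + 1) x - Mx T f n (T x)) ∂μ) atTop
        (𝓝 (∫ x, f x ∂μ)) := by
      refine tendsto_integral_of_dominated_convergence (fun x => |f x| + |f (T x)|) ?_ ?_ ?_ ?_
      · intro n
        exact ((Mx_measurable hT.measurable hm (n + 1)).sub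
          ((Mx_measurable hT.measurable hm n).comp hT.measurable)).aestronglyMeasurable
      · exact hf.abs.add (hT.toMeasurePreserving.integrable_comp_of_integrable hf).abs
      · intro n
        refine Eventually.of_forall fun x => ?_
        have h0 : f (T x) ≤ Mx T f n (T x) := hmono (T x) (Nat.zero_le n)
        have e : Mx T f (n + 1) x - Mx T f n (T x) = f x + max 0 (-Mx T f n (T x)) := by
          simp only [Mx]
          rcases le_total 0 (Mx T f n (T x)) with h | h
          · rw [max_eq_right h, max_eq_left (by linarith)]; ring
          · rw [max_eq_left h, max_eq_right (by linarith)]; ring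
        rw [e, Real.norm_eq_abs]
        refine (abs_add_le _ _).trans (add_le_add le_rfl ?_)
        rw [abs_of_nonneg (le_max_left _ _)]
        refine max_le (abs_nonneg _) ?_
        have := neg_abs_le (f (T x))
        linarith
      · filter_upwards [hae'] with x hx
        have : ∃ n, 0 ≤ Mx T f n (T x) := by
          by_contra! hcon
          exact hx ⟨0, by rintro _ ⟨n, rfl⟩; exact (hcon n).le⟩
        obtain ⟨N, hN⟩ := this
        refine tendsto_const_nhds.congr' ?_
        filter_upwards [eventually_ge_atTop N] with n hn
        have : 0 ≤ Mx T f n (T x) := hN.trans (hmono (T x) hn)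
        simp only [Mx]
        rw [max_eq_right this]; ring
    have hge : ∀ n, 0 ≤ ∫ x, (Mx T f (n + 1) x - Mx T f n (T x)) ∂μ := by
      intro n
      have i1 := Mx_integrable hT.toMeasurePreserving hf (n + 1)
      have i2 := Mx_integrable hT.toMeasurePreserving hf n
      have i3 := hT.toMeasurePreserving.integrable_comp_of_integrable i2
      have e3 : ∫ x, Mx T f n (T x) ∂μ = ∫ x, Mx T f n x ∂μ := by
        have := integral_map (μ := μ) hT.measurable.aemeasurable
          (f := Mx T f n) (Mx_measurable hT.measurable hm n).aestronglyMeasurable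
        rw [hT.map_eq] at this
        exact this.symm
      have i3' : Integrable (fun x => Mx T f n (T x)) μ := i3
      rw [integral_sub i1 i3', e3, ← integral_sub i1 i2]
      exact integral_nonneg fun x => sub_nonneg.2 (Mx_mono T f n x)
    exact absurd (ge_of_tendsto' hlim hge) (not_le.2 hneg)
  · filter_upwards [h] with x hx
    have h2 : (x ∈ B) = (x ∈ (univ : Set Ω)) := hx
    have : x ∈ B := by rw [h2]; trivial
    exact this

lemma birkhoff_upper {Ω : Type*} [MeasurableSpace Ω] {μ : Measure Ω} [IsProbabilityMeasure μ]
    {T : Ω → Ω} {f : Ω → ℝ} (hT : Ergodic T μ) (hm : Measurable f) (hf : Integrable f μ) :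
    ∀ᵐ x ∂μ, ∀ c : ℝ, ∫ x, f x ∂μ < c → ∀ᶠ n : ℕ in atTop, birkhoffSum T f n x / n < c := by
  have key : ∀ q : ℚ, ∫ x, f x ∂μ < q →
      ∀ᵐ x ∂μ, BddAbove (range fun n => Mx T (fun x => f x - q) n x) := by
    intro q hq
    refine birkhoff_bdd hT (hm.sub_const _) (hf.sub (integrable_const _)) ?_
    rw [integral_sub hf (integrable_const _)]
    simp; exact hq
  have key2 : ∀ᵐ x ∂μ, ∀ q : ℚ, ∫ x, f x ∂μ < q →
      BddAbove (range fun n => Mx T (fun x => f x - q) n x) := by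
    rw [ae_all_iff]
    intro q
    by_cases hq : ∫ x, f x ∂μ < q
    · filter_upwards [key q hq] with x hx _ using hx
    · exact Eventually.of_forall fun x h => absurd h hq
  filter_upwards [key2] with x hx c hc
  obtain ⟨q, hq1, hq2⟩ := exists_rat_btwn hc
  obtain ⟨C, hC⟩ := hx q hq1
  have hS : ∀ n : ℕ, birkhoffSum T f (n + 1) x ≤ C + (n + 1) * q := by
    intro n
    have h1 := (sum_le_Mx T (fun x => f x - q) n x).trans (hC ⟨n, rfl⟩)
    have h2 : birkhoffSum T (fun x => f x - (q : ℝ)) (n + 1) x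
        = birkhoffSum T f (n + 1) x - (n + 1) * q := by
      simp [birkhoffSum, Finset.sum_sub_distrib]
    linarith
  have hlim : Tendsto (fun n : ℕ => C / (n : ℝ)) atTop (𝓝 0) := tendsto_const_div_atTop_nhds_zero_nat C
  filter_upwards [hlim.eventually (gt_mem_nhds (sub_pos.2 hq2)), eventually_gt_atTop 0] with n h1 h2
  obtain ⟨m, rfl⟩ : ∃ m, n = m + 1 := ⟨n - 1, by omega⟩
  have hpos : (0 : ℝ) < ((m + 1 : ℕ) : ℝ) := by positivity
  rw [div_lt_iff₀ hpos] at h1 ⊢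
  have := hS m
  push_cast at *
  linarith

theorem birkhoff_ae {Ω : Type*} [MeasurableSpace Ω] {μ : Measure Ω} [IsProbabilityMeasure μ]
    {T : Ω → Ω} {f : Ω → ℝ} (hT : Ergodic T μ) (hm : Measurable f) (hf : Integrable f μ) :
    ∀ᵐ x ∂μ, Tendsto (fun n : ℕ => birkhoffSum T f n x / n) atTop (𝓝 (∫ x, f x ∂μ)) := by
  filter_upwards [birkhoff_upper hT hm hf, birkhoff_upper hT hm.neg hf.neg] with x h1 h2
  rw [tendsto_order]
  refine ⟨fun c hc => ?_, fun c hc => h1 c hc⟩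
  have h3 := h2 (-c) (by simp only [Pi.neg_apply]; rw [integral_neg]; linarith)
  filter_upwards [h3] with n hn
  have : birkhoffSum T (-f) n x = - birkhoffSum T f n x := by simp [birkhoffSum]
  rw [this, neg_div] at hn
  linarith


/-- Moebius action of a real `2×2` matrix. -/
noncomputable def mob (M : Matrix (Fin 2) (Fin 2) ℝ) (y : ℝ) : ℝ :=
  (M 0 0 * y + M 0 1) / (M 1 0 * y + M 1 1)

/-- The square root of the absolute derivative of the map. -/
noncomputable def jac (x : ℝ) : ℝ := if x ≤ 1 / 2 then 1 / x else (1 + T x) / (1 - x)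

lemma valid_cases {d : Digit} (hd : d.Valid) :
    (∃ n : ℕ, d = ⟨n + 1, 1, Par.e⟩) ∨ (∃ n : ℕ, d = ⟨n + 2, -1, Par.e⟩) ∨
    (∃ n : ℕ, d = ⟨n + 2, 1, Par.o⟩) ∨ (∃ n : ℕ, d = ⟨n + 2, -1, Par.o⟩) := by
  obtain ⟨a, eps, s⟩ := d
  rcases hd with ⟨h1, h2⟩ | ⟨h1, h2, h3⟩
  · simp only at h1 h2
    cases s <;> rcases h2 with rfl | rfl
    · exact Or.inl ⟨(a - 1).toNat, by simp; omega⟩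
    · exact Or.inr (Or.inl ⟨(a - 2).toNat, by simp; omega⟩)
    · exact Or.inr (Or.inr (Or.inl ⟨(a - 2).toNat, by simp; omega⟩))
    · exact Or.inr (Or.inr (Or.inr ⟨(a - 2).toNat, by simp; omega⟩))
  · simp only at h1 h2 h3
    subst h1 h2 h3
    exact Or.inl ⟨0, by simp⟩

lemma Mdig_ep (a : ℤ) : Mdig ⟨a, 1, Par.e⟩ = !![0, 1; 1, 2 * (a : ℝ)] := by simp [Mdig]
lemma Mdig_em (a : ℤ) : Mdig ⟨a, -1, Par.e⟩ = !![0, 1; -1, 2 * (a : ℝ)] := by simp [Mdig]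
lemma Mdig_op (a : ℤ) : Mdig ⟨a, 1, Par.o⟩ = !![(a : ℝ) - 1, a; a, (a : ℝ) + 1] := by
  simp [Mdig]
lemma Mdig_om (a : ℤ) : Mdig ⟨a, -1, Par.o⟩ = !![(a : ℝ), a - 1; a + 1, (a : ℝ)] := by
  simp [Mdig]; ring

lemma iota_iota {y : ℝ} (hy : 0 < y) : iota (iota y) = y := by
  unfold iota
  have : 1 + y ≠ 0 := by positivity
  have h2 : 1 + (1 - y) / (1 + y) = 2 / (1 + y) := by field_simp; ring
  rw [h2]; field_simp; ring

lemma iota_mem {y : ℝ} (hy : y ∈ Ioo (0 : ℝ) 1) : iota y ∈ Ioo (0 : ℝ) 1 := by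
  have h1 : 0 < 1 + y := by linarith [hy.1]
  refine ⟨div_pos (by linarith [hy.2]) h1, ?_⟩
  unfold iota
  rw [div_lt_one h1]; linarith [hy.1]

lemma Te_of {x y : ℝ} {a : ℤ} (hy : y ∈ Ioo (0 : ℝ) 1)
    (hx : 1 / x = 2 * a + y ∨ 1 / x = 2 * a - y) : Te x = y := by
  have hf : ⌊(1 / x + 1) / 2⌋ = a := by
    rw [Int.floor_eq_iff]
    obtain ⟨h1, h2⟩ := hy
    rcases hx with h | h <;> rw [h] <;> constructor <;> linarith
  unfold Te
  rw [hf]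
  rcases hx with h | h <;> rw [h]
  · rw [abs_of_nonneg] <;> linarith [hy.1]
  · rw [abs_of_nonpos] <;> linarith [hy.1]

/-- Facts about the inverse branch attached to a digit. -/
lemma mob_facts {d : Digit} (hd : d.Valid) {y : ℝ} (hy : y ∈ Ioo (0 : ℝ) 1) :
    0 < Mdig d 1 0 * y + Mdig d 1 1 ∧ mob (Mdig d) y ∈ Ioo (0 : ℝ) 1 ∧
    T (mob (Mdig d) y) = y ∧ jac (mob (Mdig d) y) = Mdig d 1 0 * y + Mdig d 1 1 := by
  obtain ⟨y0, y1⟩ := hy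
  have hy : y ∈ Ioo (0 : ℝ) 1 := ⟨y0, y1⟩
  have even : ∀ (z : ℝ) (a : ℤ), 2 ≤ z → (z = 2 * a + y ∨ z = 2 * a - y) →
      1 / z ∈ Ioo (0 : ℝ) 1 ∧ T (1 / z) = y ∧ jac (1 / z) = z := by
    intro z a hz h
    have hp : 0 < 1 / z := by positivity
    have hle : 1 / z ≤ 1 / 2 := one_div_le_one_div_of_le (by norm_num) hz
    have : (1 / z) ∈ Ioo (0 : ℝ) 1 := ⟨hp, by linarith⟩
    refine ⟨this, ?_, ?_⟩
    · unfold T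
      rw [if_neg (not_le.2 hp), if_neg (by linarith), if_pos hle]
      exact Te_of (a := a) hy (by simpa using h)
    · unfold jac
      rw [if_pos hle]; simp
  have odd : ∀ (x z : ℝ) (a : ℤ), 0 < z → 1 / 2 < x → x < 1 → 1 - x = (1 + y) / z →
      (1 / iota x = 2 * a + iota y ∨ 1 / iota x = 2 * a - iota y) →
      x ∈ Ioo (0 : ℝ) 1 ∧ T x = y ∧ jac x = z := by
    intro x z a hz h1 h2 h3 h4
    have hT : T x = y := by
      unfold T
      rw [if_neg (by linarith), if_neg (by linarith), if_neg (by linarith),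
        Te_of (iota_mem hy) h4, iota_iota y0]
    refine ⟨⟨by linarith, h2⟩, hT, ?_⟩
    unfold jac
    rw [if_neg (by linarith), hT, h3]
    field_simp
  rcases valid_cases hd with ⟨n, rfl⟩ | ⟨n, rfl⟩ | ⟨n, rfl⟩ | ⟨n, rfl⟩
  · rw [Mdig_ep]
    have hn : (0 : ℝ) ≤ n := by positivity
    have := even (1 * y + 2 * ((n + 1 : ℤ) : ℝ)) (n + 1) (by push_cast; linarith)
      (Or.inl (by ring))
    simp only [mob, Matrix.of_apply, Matrix.cons_val', Matrix.cons_val_zero, Matrix.cons_val_one,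
      Matrix.cons_val_fin_one, zero_mul, zero_add]
    refine ⟨?_, this.1, this.2.1, this.2.2⟩
    push_cast; nlinarith
  · rw [Mdig_em]
    have hn : (0 : ℝ) ≤ n := by positivity
    have := even (-1 * y + 2 * ((n + 2 : ℤ) : ℝ)) (n + 2) (by push_cast; linarith)
      (Or.inr (by ring))
    simp only [mob, Matrix.of_apply, Matrix.cons_val', Matrix.cons_val_zero, Matrix.cons_val_one,
      Matrix.cons_val_fin_one, zero_mul, zero_add]
    refine ⟨?_, this.1, this.2.1, this.2.2⟩
    push_cast; nlinarith
  · rw [Mdig_op]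
    have hn : (0 : ℝ) ≤ n := by positivity
    have hny : 0 ≤ n * y := by positivity
    simp only [mob, Matrix.of_apply, Matrix.cons_val', Matrix.cons_val_zero, Matrix.cons_val_one,
      Matrix.cons_val_fin_one]
    push_cast
    have hz : 0 < ((n : ℝ) + 2) * y + (n + 2 + 1) := by positivity
    refine ⟨hz, odd _ _ (n + 2) hz ?_ ?_ ?_ (Or.inl ?_)⟩
    · rw [lt_div_iff₀ hz]; nlinarith
    · rw [div_lt_one hz]; nlinarith
    · field_simp; ring
    · unfold iota
      have : ((n : ℝ) + 2) * y + (n + 2 + 1) - ((n + 2 - 1) * y + (n + 2)) = 1 + y := by ring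
      push_cast
      rw [show (1 - ((n + 2 - 1) * y + (n + 2)) / (((n : ℝ) + 2) * y + (n + 2 + 1))) =
        (1 + y) / (((n : ℝ) + 2) * y + (n + 2 + 1)) by field_simp; ring]
      rw [show (1 + ((n + 2 - 1) * y + (n + 2)) / (((n : ℝ) + 2) * y + (n + 2 + 1))) =
        ((2 * n + 3) * y + (2 * n + 5)) / (((n : ℝ) + 2) * y + (n + 2 + 1)) by field_simp; ring]
      have h1 : 0 < 1 + y := by linarith
      have h2 : 0 < (2 * (n : ℝ) + 3) * y + (2 * n + 5) := by positivity
      field_simp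
      ring
  · rw [Mdig_om]
    have hn : (0 : ℝ) ≤ n := by positivity
    have hny : 0 ≤ n * y := by positivity
    simp only [mob, Matrix.of_apply, Matrix.cons_val', Matrix.cons_val_zero, Matrix.cons_val_one,
      Matrix.cons_val_fin_one]
    push_cast
    have hz : 0 < ((n : ℝ) + 2 + 1) * y + (n + 2) := by positivity
    refine ⟨hz, odd _ _ (n + 2) hz ?_ ?_ ?_ (Or.inr ?_)⟩
    · rw [lt_div_iff₀ hz]; nlinarith
    · rw [div_lt_one hz]; nlinarith
    · field_simp; ring
    · unfold iota
      push_cast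
      rw [show (1 - ((n + 2) * y + (n + 2 - 1)) / (((n : ℝ) + 2 + 1) * y + (n + 2))) =
        (1 + y) / (((n : ℝ) + 2 + 1) * y + (n + 2)) by field_simp; ring]
      rw [show (1 + ((n + 2) * y + (n + 2 - 1)) / (((n : ℝ) + 2 + 1) * y + (n + 2))) =
        ((2 * n + 5) * y + (2 * n + 3)) / (((n : ℝ) + 2 + 1) * y + (n + 2)) by field_simp; ring]
      have h1 : 0 < 1 + y := by linarith
      have h2 : 0 < (2 * (n : ℝ) + 5) * y + (2 * n + 3) := by positivity
      field_simp
      ring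

lemma Irrational.ne_div {x : ℝ} (hx : Irrational x) (p q : ℤ) : x ≠ (p : ℝ) / q := by
  intro h
  exact hx ⟨(p : ℚ) / q, by push_cast; exact h.symm⟩

lemma branch_mob {d : Digit} (hd : d.Valid) {x : ℝ} (hx : x ∈ branch d) (hi : Irrational x) :
    ∃ y ∈ Ioo (0 : ℝ) 1, x = mob (Mdig d) y := by
  rcases valid_cases hd with ⟨n, rfl⟩ | ⟨n, rfl⟩ | ⟨n, rfl⟩ | ⟨n, rfl⟩
  · have hn : (0 : ℝ) ≤ n := by positivity
    have hx' : 1 / (2 * ((n : ℝ) + 1) + 1) ≤ x ∧ x ≤ 1 / (2 * ((n : ℝ) + 1)) := by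
      by_cases h0 : n = 0
      · subst h0
        simp only [branch] at hx
        norm_num at hx ⊢
        exact hx
      · simp only [branch] at hx
        rw [if_neg (by omega), if_pos trivial] at hx
        push_cast at hx
        exact ⟨hx.1, hx.2.le⟩
    have e1 := Irrational.ne_div hi 1 (2 * (n + 1) + 1)
    have e2 := Irrational.ne_div hi 1 (2 * (n + 1))
    push_cast at e1 e2
    have h1 := lt_of_le_of_ne hx'.1 e1.symm
    have h2 := lt_of_le_of_ne hx'.2 e2
    have hx0 : 0 < x := lt_trans (by positivity) h1
    rw [div_lt_iff₀ (by positivity)] at h1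
    rw [lt_div_iff₀ (by positivity)] at h2
    refine ⟨1 / x - 2 * (n + 1), ⟨?_, ?_⟩, ?_⟩
    · rw [sub_pos, lt_div_iff₀ hx0]; linarith
    · rw [sub_lt_iff_lt_add, div_lt_iff₀ hx0]; linarith
    · rw [Mdig_ep]
      simp [mob]
  · have hn : (0 : ℝ) ≤ n := by positivity
    simp only [branch] at hx
    rw [if_neg (by omega), if_neg (by norm_num)] at hx
    push_cast at hx
    have e1 := Irrational.ne_div hi 1 (2 * (n + 2))
    push_cast at e1
    have h1 := lt_of_le_of_ne hx.1 e1.symm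
    have h2 := hx.2
    have hx0 : 0 < x := lt_trans (by positivity) h1
    rw [div_lt_iff₀ (by positivity)] at h1
    rw [lt_div_iff₀ (by linarith)] at h2
    refine ⟨2 * (n + 2) - 1 / x, ⟨?_, ?_⟩, ?_⟩
    · rw [sub_pos, div_lt_iff₀ hx0]; linarith
    · rw [sub_lt_comm, lt_div_iff₀ hx0]; linarith
    · rw [Mdig_em]
      simp [mob]
  · have hn : (0 : ℝ) ≤ n := by positivity
    simp only [branch] at hx
    rw [if_pos trivial] at hx
    push_cast at hx
    have e1 := Irrational.ne_div hi (n + 2) (n + 2 + 1)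
    push_cast at e1
    have h2 := lt_of_le_of_ne hx.2 e1
    have h1 := hx.1
    rw [div_lt_iff₀ (by positivity)] at h1
    rw [lt_div_iff₀ (by positivity)] at h2
    have hden : 0 < (n + 2) * x - (n + 1) := by nlinarith
    have hnum : 0 < (n + 2) - (n + 3) * x := by linarith
    refine ⟨((n + 2) - (n + 3) * x) / ((n + 2) * x - (n + 1)), ⟨by positivity, ?_⟩, ?_⟩
    · rw [div_lt_one hden]; linarith
    · rw [Mdig_op]
      simp only [mob, Matrix.of_apply, Matrix.cons_val', Matrix.cons_val_zero,
        Matrix.cons_val_one, Matrix.cons_val_fin_one]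
      push_cast
      have hy := div_mul_cancel₀ ((n + 2) - (n + 3) * x) hden.ne'
      rw [eq_div_iff (by positivity)]
      linear_combination hy
  · have hn : (0 : ℝ) ≤ n := by positivity
    simp only [branch] at hx
    rw [if_neg (by norm_num)] at hx
    push_cast at hx
    have e1 := Irrational.ne_div hi (2 * (n + 2) - 1) (2 * (n + 2) + 1)
    push_cast at e1
    have h2 := lt_of_le_of_ne hx.2 e1
    have h1 := hx.1
    rw [div_lt_iff₀ (by positivity)] at h1
    rw [lt_div_iff₀ (by positivity)] at h2
    have hnum : 0 < (n + 2) * x - (n + 1) := by linarith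
    have hden : 0 < (n + 2) - (n + 3) * x := by nlinarith
    refine ⟨((n + 2) * x - (n + 1)) / ((n + 2) - (n + 3) * x), ⟨by positivity, ?_⟩, ?_⟩
    · rw [div_lt_one hden]; linarith
    · rw [Mdig_om]
      simp only [mob, Matrix.of_apply, Matrix.cons_val', Matrix.cons_val_zero,
        Matrix.cons_val_one, Matrix.cons_val_fin_one]
      push_cast
      have hy := div_mul_cancel₀ ((n + 2) * x - (n + 1)) hden.ne'
      rw [eq_div_iff (by positivity)]
      linear_combination -hy

lemma exists_digit {x : ℝ} (hx : x ∈ Ioo (0 : ℝ) 1) (hi : Irrational x) :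
    ∃ d : Digit, d.Valid ∧ x ∈ branch d := by
  obtain ⟨x0, x1⟩ := hx
  have hne : x ≠ 1 / 2 := by simpa using Irrational.ne_div hi 1 2
  rcases lt_or_gt_of_ne hne with h | h
  · -- even part
    set k := ⌊(1 / x + 1) / 2⌋ with hk
    have h1 : (k : ℝ) ≤ (1 / x + 1) / 2 := Int.floor_le _
    have h2 : (1 / x + 1) / 2 < k + 1 := Int.lt_floor_add_one _
    have hz : 2 < 1 / x := by rw [lt_div_iff₀ x0]; linarith
    have hk1 : (1 : ℤ) ≤ k := by
      rw [hk, Int.le_floor]; push_cast; linarith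
    have hk1' : (1 : ℝ) ≤ k := by exact_mod_cast hk1
    have g1 : (2 * k - 1) * x ≤ 1 := by
      rw [← le_div_iff₀ x0]; linarith
    have g2 : 1 < (2 * k + 1) * x := by
      rw [← div_lt_iff₀ x0]; linarith
    by_cases hc : x < 1 / (2 * (k : ℝ))
    · refine ⟨⟨k, 1, Par.e⟩, ?_, ?_⟩
      · unfold Digit.Valid
        simp only
        rcases eq_or_lt_of_le hk1 with h | h
        · right; simp [← h]
        · left; exact ⟨by omega, Or.inl trivial⟩
      · simp only [branch]
        have l1 : 1 / (2 * (k : ℝ) + 1) ≤ x := by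
          rw [div_le_iff₀ (by linarith)]; linarith
        split_ifs with h1
        · rw [h1] at l1 hc
          norm_num at l1 hc ⊢
          exact ⟨l1, hc.le⟩
        · exact ⟨l1, hc⟩
    · have hk2 : (2 : ℤ) ≤ k := by
        rcases eq_or_lt_of_le hk1 with h' | h'
        · exfalso; apply hc; rw [← h']; norm_num; linarith
        · omega
      have hk2' : (2 : ℝ) ≤ k := by exact_mod_cast hk2
      have e1 := Irrational.ne_div hi 1 (2 * k - 1)
      push_cast at e1
      refine ⟨⟨k, -1, Par.e⟩, Or.inl ⟨hk2, Or.inr rfl⟩, ?_⟩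
      simp only [branch]
      rw [if_neg (by omega), if_neg (by norm_num)]
      refine ⟨not_lt.1 hc, lt_of_le_of_ne ?_ e1⟩
      rw [le_div_iff₀ (by linarith)]; linarith
  · -- odd part
    set k := ⌊((1 + x) / (1 - x) + 1) / 2⌋ with hk
    have h1 : (k : ℝ) ≤ ((1 + x) / (1 - x) + 1) / 2 := Int.floor_le _
    have h2 : ((1 + x) / (1 - x) + 1) / 2 < k + 1 := Int.lt_floor_add_one _
    have x2 : 0 < 1 - x := by linarith
    have hz : 3 < (1 + x) / (1 - x) := by rw [lt_div_iff₀ x2]; linarith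
    have hk1 : (2 : ℤ) ≤ k := by
      rw [hk, Int.le_floor]; push_cast; linarith
    have hk1' : (2 : ℝ) ≤ k := by exact_mod_cast hk1
    have g1 : (2 * k - 1) * (1 - x) ≤ 1 + x := by
      rw [← le_div_iff₀ x2]; linarith
    have g2 : 1 + x < (2 * k + 1) * (1 - x) := by
      rw [← div_lt_iff₀ x2]; linarith
    by_cases hc : x ≤ (2 * (k : ℝ) - 1) / (2 * k + 1)
    · have e1 := Irrational.ne_div hi (k - 1) k
      push_cast at e1
      refine ⟨⟨k, -1, Par.o⟩, Or.inl ⟨hk1, Or.inr rfl⟩, ?_⟩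
      simp only [branch]
      rw [if_neg (by norm_num)]
      refine ⟨lt_of_le_of_ne ?_ e1.symm, hc⟩
      rw [div_le_iff₀ (by linarith)]; linarith
    · refine ⟨⟨k, 1, Par.o⟩, Or.inl ⟨hk1, Or.inl rfl⟩, ?_⟩
      simp only [branch]
      rw [if_pos trivial]
      refine ⟨not_le.1 hc, ?_⟩
      rw [le_div_iff₀ (by linarith)]; linarith

/-- The set of irrational points of `(0,1)`. -/
def Good : Set ℝ := {x | x ∈ Ioo (0 : ℝ) 1 ∧ Irrational x}

lemma digit_spec {x : ℝ} (hx : x ∈ Good) : (digit x).Valid ∧ x ∈ branch (digit x) := by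
  have h := exists_digit hx.1 hx.2
  unfold digit
  rw [dif_pos h]
  exact h.choose_spec

lemma Mdig_rat (d : Digit) (i j : Fin 2) : ∃ q : ℚ, (q : ℝ) = Mdig d i j := by
  obtain ⟨a, eps, s⟩ := d
  cases s
  · fin_cases i <;> fin_cases j
    · exact ⟨0, by simp [Mdig]⟩
    · exact ⟨1, by simp [Mdig]⟩
    · exact ⟨eps, by simp [Mdig]⟩
    · exact ⟨2 * a, by simp [Mdig]⟩
  · fin_cases i <;> fin_cases j
    · exact ⟨a - (max 0 eps : ℤ), by simp [Mdig]⟩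
    · exact ⟨a - (max 0 eps : ℤ) + eps, by simp [Mdig]⟩
    · exact ⟨a - (max 0 eps : ℤ) + 1, by simp [Mdig]⟩
    · exact ⟨a - (max 0 eps : ℤ) + eps + 1, by simp [Mdig]⟩

/-- One step of the map at a good point. -/
lemma good_step {x : ℝ} (hx : x ∈ Good) :
    (digit x).Valid ∧ T x ∈ Good ∧ mob (Mdig (digit x)) (T x) = x ∧
    jac x = Mdig (digit x) 1 0 * T x + Mdig (digit x) 1 1 ∧ 0 < jac x := by
  obtain ⟨hv, hb⟩ := digit_spec hx
  obtain ⟨y, hy, hxy⟩ := branch_mob hv hb hx.2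
  obtain ⟨h1, h2, h3, h4⟩ := mob_facts hv hy
  rw [← hxy] at h3 h4
  rw [h3]
  refine ⟨hv, ⟨hy, ?_⟩, hxy.symm, h4, by rw [h4]; exact h1⟩
  rintro ⟨q, rfl⟩
  apply hx.2
  obtain ⟨q0, e0⟩ := Mdig_rat (digit x) 0 0
  obtain ⟨q1, e1⟩ := Mdig_rat (digit x) 0 1
  obtain ⟨q2, e2⟩ := Mdig_rat (digit x) 1 0
  obtain ⟨q3, e3⟩ := Mdig_rat (digit x) 1 1
  refine ⟨(q0 * q + q1) / (q2 * q + q3), ?_⟩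
  rw [hxy]
  unfold mob
  rw [← e0, ← e1, ← e2, ← e3]
  push_cast
  rfl


lemma sq3 : √3 * √3 = 3 := Real.mul_self_sqrt (by norm_num)
lemma sq3_lo : (1.7 : ℝ) < √3 := Real.lt_sqrt_of_sq_lt (by norm_num)
lemma sq3_hi : √3 < (1.8 : ℝ) := by rw [Real.sqrt_lt' (by norm_num)]; norm_num

lemma row_step {d : Digit} (hd : d.Valid) {C D : ℝ} (hD : 0 < D) (h1 : (√3 - 2) * D ≤ C)
    (h2 : C ≤ √3 * D) :
    3 / 2 * D ≤ C * Mdig d 0 1 + D * Mdig d 1 1 ∧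
    (√3 - 2) * (C * Mdig d 0 1 + D * Mdig d 1 1) ≤ C * Mdig d 0 0 + D * Mdig d 1 0 ∧
    C * Mdig d 0 0 + D * Mdig d 1 0 ≤ √3 * (C * Mdig d 0 1 + D * Mdig d 1 1) := by
  have r2 := sq3
  have r1 := sq3_lo
  have r3 := sq3_hi
  set r := √3
  obtain ⟨u, hu⟩ : ∃ u, u = C - (r - 2) * D := ⟨_, rfl⟩
  have hu0 : 0 ≤ u := by linarith
  have hC : C = (r - 2) * D + u := by linarith
  have hv : 0 ≤ 2 * D - u := by linarith
  have hr0 : 0 < r := by linarith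
  have hr2 : 0 < 2 - r := by linarith
  have hr1 : 0 < r - 1.7 := by linarith
  rcases valid_cases hd with ⟨n, rfl⟩ | ⟨n, rfl⟩ | ⟨n, rfl⟩ | ⟨n, rfl⟩
  · have hn : (0 : ℝ) ≤ n := by positivity
    have hnD : 0 ≤ n * D := by positivity
    rw [Mdig_ep]
    simp only [Matrix.of_apply, Matrix.cons_val', Matrix.cons_val_zero, Matrix.cons_val_one,
      Matrix.cons_val_fin_one]
    push_cast
    have e : C * 1 + D * (2 * ((n : ℝ) + 1)) = r * D + 2 * (n * D) + u := by rw [hC]; ring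
    rw [e]
    have hrD := mul_pos hr1 hD
    refine ⟨by nlinarith, ?_, ?_⟩
    · have : 0 ≤ (2 - r) * (r * D + 2 * (n * D) + u) := by positivity
      nlinarith
    · have : 0 ≤ r * (2 * (n * D) + u) := by positivity
      have : r * (r * D) = 3 * D := by rw [← mul_assoc, r2]
      nlinarith
  · have hn : (0 : ℝ) ≤ n := by positivity
    have hnD : 0 ≤ n * D := by positivity
    rw [Mdig_em]
    simp only [Matrix.of_apply, Matrix.cons_val', Matrix.cons_val_zero, Matrix.cons_val_one,
      Matrix.cons_val_fin_one]
    push_cast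
    have e : C * 1 + D * (2 * ((n : ℝ) + 2)) = (2 + r) * D + 2 * (n * D) + u := by rw [hC]; ring
    rw [e]
    have hrD := mul_pos hr1 hD
    refine ⟨by nlinarith, ?_, ?_⟩
    · have : 0 ≤ (2 - r) * (2 * (n * D) + u) := by positivity
      have : (2 - r) * ((2 + r) * D) = D := by linear_combination (-D) * r2
      nlinarith
    · have : 0 ≤ r * ((2 + r) * D + 2 * (n * D) + u) := by positivity
      nlinarith
  · have hn : (0 : ℝ) ≤ n := by positivity
    rw [Mdig_op]
    simp only [Matrix.of_apply, Matrix.cons_val', Matrix.cons_val_zero, Matrix.cons_val_one,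
      Matrix.cons_val_fin_one]
    push_cast
    obtain ⟨E, hE⟩ : ∃ E, E = C + D := ⟨_, rfl⟩
    have hrD := mul_pos hr1 hD
    have hE0 : 0.7 * D ≤ E := by rw [hE, hC]; nlinarith
    have hEp : 0 < E := by linarith
    have hnE : 0 ≤ n * E := by positivity
    have e : C * ((n : ℝ) + 2) + D * (n + 2 + 1) = n * E + 2 * E + D := by rw [hE]; ring
    have e' : C * ((n : ℝ) + 2 - 1) + D * (n + 2) = n * E + E + D := by rw [hE]; ring
    rw [e, e']
    refine ⟨by nlinarith, ?_, ?_⟩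
    · have : 0 ≤ (2 - r) * (n * E + 2 * E + D) := by positivity
      nlinarith
    · have : 0 ≤ (r - 1.7) * (n * E + 2 * E + D) := by positivity
      nlinarith
  · have hn : (0 : ℝ) ≤ n := by positivity
    rw [Mdig_om]
    simp only [Matrix.of_apply, Matrix.cons_val', Matrix.cons_val_zero, Matrix.cons_val_one,
      Matrix.cons_val_fin_one]
    push_cast
    obtain ⟨E, hE⟩ : ∃ E, E = C + D := ⟨_, rfl⟩
    have hrD := mul_pos hr1 hD
    have hE0 : 0.7 * D ≤ E := by rw [hE, hC]; nlinarith
    have hEp : 0 < E := by linarith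
    have hnE : 0 ≤ n * E := by positivity
    have e : C * ((n : ℝ) + 2 - 1) + D * (n + 2) = n * E + E + D := by rw [hE]; ring
    have e' : C * ((n : ℝ) + 2) + D * (n + 2 + 1) = n * E + 2 * E + D := by rw [hE]; ring
    rw [e, e']
    refine ⟨by nlinarith, ?_, ?_⟩
    · have : 0 ≤ (2 - r) * (n * E + E + D) := by positivity
      nlinarith
    · have h3 : 0 ≤ (r - 1.7) * (n * E) := by positivity
      have h4 : 0 ≤ (2 - r) * ((r + 1) * D - E) := by
        apply mul_nonneg hr2.le
        rw [hE]; nlinarith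
      have h5 : (2 - r) * ((r + 1) * D) = (r - 1) * D := by linear_combination (-D) * r2
      nlinarith

lemma Mdig_det {d : Digit} (hd : d.Valid) : |(Mdig d).det| = 1 := by
  rcases valid_cases hd with ⟨n, rfl⟩ | ⟨n, rfl⟩ | ⟨n, rfl⟩ | ⟨n, rfl⟩
  · rw [Mdig_ep, Matrix.det_fin_two_of]; norm_num
  · rw [Mdig_em, Matrix.det_fin_two_of]; norm_num
  · rw [Mdig_op, Matrix.det_fin_two_of]; push_cast; ring_nf; norm_num
  · rw [Mdig_om, Matrix.det_fin_two_of]; push_cast; ring_nf; norm_num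

lemma Mn_succ (n : ℕ) (x : ℝ) : Mn (n + 1) x = Mn n x * Mdig (digit (T^[n] x)) := by
  simp [Mn, List.range_succ]

lemma good_iter {x : ℝ} (hx : x ∈ Good) (n : ℕ) : T^[n] x ∈ Good := by
  induction n with
  | zero => exact hx
  | succ n ih => rw [Function.iterate_succ_apply']; exact (good_step ih).2.1

lemma Mn_facts {x : ℝ} (hx : x ∈ Good) (n : ℕ) :
    (3 / 2 : ℝ) ^ n ≤ Mn n x 1 1 ∧ (√3 - 2) * Mn n x 1 1 ≤ Mn n x 1 0 ∧
    Mn n x 1 0 ≤ √3 * Mn n x 1 1 ∧ |(Mn n x).det| = 1 := by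
  induction n with
  | zero =>
    have := sq3_hi
    have : (0 : ℝ) ≤ √3 := Real.sqrt_nonneg 3
    simp [Mn]
    linarith
  | succ n ih =>
    obtain ⟨h1, h2, h3, h4⟩ := ih
    obtain ⟨hv, -⟩ := good_step (good_iter hx n)
    have hD : 0 < Mn n x 1 1 := lt_of_lt_of_le (by positivity) h1
    obtain ⟨g1, g2, g3⟩ := row_step hv hD h2 h3
    rw [Mn_succ, Matrix.det_mul, abs_mul, h4, Mdig_det hv]
    simp only [Matrix.mul_apply, Fin.sum_univ_two]
    refine ⟨?_, g2, g3, by norm_num⟩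
    refine le_trans ?_ g1
    rw [pow_succ]; linarith

lemma Mn_den {x : ℝ} (hx : x ∈ Good) (n : ℕ) {y : ℝ} (hy : y ∈ Icc (0 : ℝ) 1) :
    (√3 - 1) * Mn n x 1 1 ≤ Mn n x 1 0 * y + Mn n x 1 1 ∧
    Mn n x 1 0 * y + Mn n x 1 1 ≤ (√3 + 1) * Mn n x 1 1 := by
  obtain ⟨h1, h2, h3, h4⟩ := Mn_facts hx n
  have hD : 0 < Mn n x 1 1 := lt_of_lt_of_le (by positivity) h1
  obtain ⟨y0, y1⟩ := hy
  have r3 := sq3_hi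
  have r0 : 0 < √3 := by positivity
  constructor
  · have e1 : (√3 - 2) * Mn n x 1 1 * y ≤ Mn n x 1 0 * y := by gcongr
    have e2 : 0 ≤ (2 - √3) * Mn n x 1 1 * (1 - y) := by
      apply mul_nonneg (mul_nonneg _ hD.le) <;> linarith
    nlinarith
  · have e1 : Mn n x 1 0 * y ≤ √3 * Mn n x 1 1 * y := by gcongr
    have e2 : 0 ≤ √3 * Mn n x 1 1 * (1 - y) := by
      apply mul_nonneg (by positivity); linarith
    nlinarith

lemma Mn_den_pos {x : ℝ} (hx : x ∈ Good) (n : ℕ) {y : ℝ} (hy : y ∈ Icc (0 : ℝ) 1) :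
    0 < Mn n x 1 0 * y + Mn n x 1 1 := by
  have h1 := (Mn_facts hx n).1
  have hD : 0 < Mn n x 1 1 := lt_of_lt_of_le (by positivity) h1
  have r1 := sq3_lo
  have := (Mn_den hx n hy).1
  have : 0 < (√3 - 1) * Mn n x 1 1 := mul_pos (by linarith) hD
  linarith

lemma mob_mul (M N : Matrix (Fin 2) (Fin 2) ℝ) (y : ℝ) (h : N 1 0 * y + N 1 1 ≠ 0) :
    mob (M * N) y = mob M (mob N y) := by
  unfold mob
  simp only [Matrix.mul_apply, Fin.sum_univ_two]
  rw [← mul_div_mul_right (M 0 0 * _ + _) _ h]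
  congr 1 <;> field_simp <;> ring

lemma T_iter_mob {x : ℝ} (hx : x ∈ Good) (n : ℕ) {y : ℝ} (hy : y ∈ Ioo (0 : ℝ) 1) :
    T^[n] (mob (Mn n x) y) = y ∧ mob (Mn n x) y ∈ Ioo (0 : ℝ) 1 := by
  induction n generalizing y with
  | zero => simpa [Mn, mob] using hy
  | succ n ih =>
    obtain ⟨hv, -⟩ := good_step (good_iter hx n)
    obtain ⟨h1, h2, h3, h4⟩ := mob_facts hv hy
    rw [Mn_succ, mob_mul _ _ _ h1.ne']
    refine ⟨?_, (ih h2).2⟩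
    rw [Function.iterate_succ_apply', (ih h2).1, h3]

lemma mob_T_iter {x : ℝ} (hx : x ∈ Good) (n : ℕ) :
    mob (Mn n x) (T^[n] x) = x := by
  induction n with
  | zero => simp [Mn, mob]
  | succ n ih =>
    obtain ⟨hv, hg, h1, h2, h3⟩ := good_step (good_iter hx n)
    rw [Mn_succ, Function.iterate_succ_apply', mob_mul _ _ _ (by rw [← h2]; exact h3.ne'), h1, ih]

/-- The logarithm of the absolute derivative of the map. -/
noncomputable def phi (x : ℝ) : ℝ := 2 * Real.log (jac x)

lemma cocycle {x : ℝ} (hx : x ∈ Good) (n : ℕ) :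
    2 * Real.log (Mn n x 1 0 * T^[n] x + Mn n x 1 1) = birkhoffSum T phi n x := by
  induction n with
  | zero => simp [Mn]
  | succ n ih =>
    have hg := good_iter hx n
    obtain ⟨hv, hg', h1, h2, h3⟩ := good_step hg
    rw [birkhoffSum_succ, ← ih]
    unfold phi
    rw [← mul_add, ← Real.log_mul (Mn_den_pos hx n (Ioo_subset_Icc_self hg.1)).ne' h3.ne']
    congr 2
    rw [Mn_succ, Function.iterate_succ_apply']
    simp only [Matrix.mul_apply, Fin.sum_univ_two]
    have h1' : Mdig (digit (T^[n] x)) 0 0 * T (T^[n] x) + Mdig (digit (T^[n] x)) 0 1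
        = T^[n] x * jac (T^[n] x) := by
      unfold mob at h1
      rw [← h2] at h1
      rw [div_eq_iff h3.ne'] at h1
      exact h1
    linear_combination Mn n x 1 0 * h1' - Mn n x 1 1 * h2

lemma log_Q_close {x : ℝ} (hx : x ∈ Good) (n : ℕ) :
    |2 * Real.log (Qc n x) - birkhoffSum T phi n x| ≤ 4 := by
  rw [← cocycle hx n]
  have hg := (good_iter hx n).1
  obtain ⟨h1, h2⟩ := Mn_den hx n (Ioo_subset_Icc_self hg)
  have hp := Mn_den_pos hx n (Ioo_subset_Icc_self hg)
  have hD : 0 < Mn n x 1 1 := lt_of_lt_of_le (by positivity) (Mn_facts hx n).1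
  have r1 := sq3_lo
  have r2 := sq3_hi
  unfold Qc
  set Z := Mn n x 1 0 * T^[n] x + Mn n x 1 1
  set D := Mn n x 1 1
  have l1 : Real.log Z ≤ Real.log D + Real.log (2.8) := by
    rw [← Real.log_mul hD.ne' (by norm_num)]
    apply Real.log_le_log hp
    nlinarith
  have l2 : Real.log D ≤ Real.log Z + Real.log 2 := by
    rw [← Real.log_mul hp.ne' (by norm_num)]
    apply Real.log_le_log hD
    nlinarith
  have l3 := Real.log_le_sub_one_of_pos (show (0 : ℝ) < 2 by norm_num)
  have l4 := Real.log_le_sub_one_of_pos (show (0 : ℝ) < 2.8 by norm_num)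
  rw [abs_le]
  constructor <;> linarith


lemma iota_measurable : Measurable iota := by unfold iota; fun_prop

lemma Te_measurable : Measurable Te := by
  have h1 : Measurable fun y : ℝ => 1 / y := by fun_prop
  have h2 : Measurable fun y : ℝ => ((⌊(1 / y + 1) / 2⌋ : ℤ) : ℝ) :=
    (measurable_from_top (f := fun k : ℤ => (k : ℝ))).comp
      (Int.measurable_floor.comp ((h1.add_const 1).div_const 2))
  exact (h1.sub (h2.const_mul 2)).abs

lemma T_measurable : Measurable T := by
  unfold T
  refine Measurable.ite measurableSet_Iic measurable_const ?_
  refine Measurable.ite measurableSet_Ici measurable_const ?_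
  refine Measurable.ite measurableSet_Iic Te_measurable ?_
  exact iota_measurable.comp (Te_measurable.comp iota_measurable)

lemma mob_deriv (M : Matrix (Fin 2) (Fin 2) ℝ) {y : ℝ} (h : M 1 0 * y + M 1 1 ≠ 0) :
    HasDerivAt (mob M) (M.det / (M 1 0 * y + M 1 1) ^ 2) y := by
  have h1 : HasDerivAt (fun y => M 0 0 * y + M 0 1) (M 0 0) y := by
    simpa using ((hasDerivAt_id y).const_mul (M 0 0)).add_const (M 0 1)
  have h2 : HasDerivAt (fun y => M 1 0 * y + M 1 1) (M 1 0) y := by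
    simpa using ((hasDerivAt_id y).const_mul (M 1 0)).add_const (M 1 1)
  have h3 := h1.div h2 h
  refine h3.congr_deriv ?_
  rw [Matrix.det_fin_two]
  congr 1
  ring

lemma mob_sub (M : Matrix (Fin 2) (Fin 2) ℝ) {y z : ℝ} (hy : 0 < M 1 0 * y + M 1 1)
    (hz : 0 < M 1 0 * z + M 1 1) : mob M y - mob M z =
      M.det * (y - z) / ((M 1 0 * y + M 1 1) * (M 1 0 * z + M 1 1)) := by
  unfold mob
  rw [div_sub_div _ _ hy.ne' hz.ne', Matrix.det_fin_two]
  congr 1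
  ring

lemma rat_null : volume {x : ℝ | ¬ Irrational x} = 0 := by
  have : {x : ℝ | ¬ Irrational x} = range ((↑) : ℚ → ℝ) := by
    ext x; simp [Irrational]
  rw [this]
  exact (countable_range _).measure_zero _

lemma ae_good : ∀ᵐ x ∂(volume.restrict (Ioo (0 : ℝ) 1)), x ∈ Good := by
  have h1 : ∀ᵐ x : ℝ, Irrational x := rat_null
  filter_upwards [ae_restrict_of_ae h1, ae_restrict_mem measurableSet_Ioo] with x a b
  exact ⟨b, a⟩

/-- Dichotomy for strictly invariant sets, with respect to Lebesgue measure. -/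
lemma invariant_dichotomy {S : Set ℝ} (hS : MeasurableSet S) (hinv : T ⁻¹' S = S) :
    volume (S ∩ Ioo (0 : ℝ) 1) = 0 ∨ volume (Sᶜ ∩ Ioo (0 : ℝ) 1) = 0 := by
  by_contra! hcon
  obtain ⟨h0, h1⟩ := hcon
  set S0 := S ∩ Ioo (0 : ℝ) 1 with hS0
  set S1 := Sᶜ ∩ Ioo (0 : ℝ) 1 with hS1
  have hS0m : MeasurableSet S0 := hS.inter measurableSet_Ioo
  have hS1m : MeasurableSet S1 := hS.compl.inter measurableSet_Ioo
  have hS1fin : volume S1 ≠ ⊤ := by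
    have : volume S1 ≤ volume (Ioo (0 : ℝ) 1) := measure_mono inter_subset_right
    exact ne_top_of_le_ne_top (by simp) this
  have hdens := IsUnifLocDoublingMeasure.ae_tendsto_measure_inter_div (volume : Measure ℝ) S0 1
  have hir : ∀ᵐ x ∂(volume.restrict S0), Irrational x := ae_restrict_of_ae rat_null
  have hmem : ∀ᵐ x ∂(volume.restrict S0), x ∈ S0 := ae_restrict_mem hS0m
  have hne : (ae (volume.restrict S0)).NeBot := by
    rw [ae_neBot]
    intro h
    rw [Measure.restrict_eq_zero] at h
    exact h0 h
  obtain ⟨x, hx1, hx2, hx3⟩ := (hdens.and (hir.and hmem)).exists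
  have hx : x ∈ Good := ⟨hx3.2, hx2⟩
  -- cylinder data
  set L : ℕ → ℝ := fun n => 1 / (Mn n x 1 1 * (Mn n x 1 0 + Mn n x 1 1)) with hL
  set w : ℕ → ℝ := fun n => (mob (Mn n x) 0 + mob (Mn n x) 1) / 2 with hw
  have hD : ∀ n, 0 < Mn n x 1 1 := fun n => lt_of_lt_of_le (by positivity) (Mn_facts hx n).1
  have hE : ∀ n, 0 < Mn n x 1 0 + Mn n x 1 1 := fun n => by
    have := Mn_den_pos hx n (y := 1) (by simp)
    simpa using this
  have hE' : ∀ n, 0.7 * Mn n x 1 1 ≤ Mn n x 1 0 + Mn n x 1 1 := fun n => by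
    have := (Mn_den hx n (y := 1) (by simp)).1
    have r1 := sq3_lo
    nlinarith [hD n]
  have hLpos : ∀ n, 0 < L n := fun n => by
    have := hD n; have := hE n
    simp only [hL]; positivity
  have hLle : ∀ n, L n ≤ 2 * (2 / 3) ^ n := by
    intro n
    have hn := (Mn_facts hx n).1
    have h32 : (1 : ℝ) ≤ (3 / 2) ^ n := one_le_pow₀ (by norm_num)
    have e : 2 * (2 / 3 : ℝ) ^ n = 2 / (3 / 2) ^ n := by
      rw [show (2 / 3 : ℝ) = (3 / 2)⁻¹ by norm_num, inv_pow, div_eq_mul_inv 2]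
    rw [e]
    simp only [hL]
    rw [div_le_div_iff₀ (mul_pos (hD n) (hE n)) (by positivity)]
    have := hE' n
    have h7 : 0.7 ≤ Mn n x 1 0 + Mn n x 1 1 := by linarith
    nlinarith [hD n]
  have hLlim : Tendsto L atTop (𝓝 0) := by
    have : Tendsto (fun n : ℕ => 2 * (2 / 3 : ℝ) ^ n) atTop (𝓝 (2 * 0)) :=
      (tendsto_pow_atTop_nhds_zero_of_lt_one (by norm_num) (by norm_num)).const_mul 2
    rw [mul_zero] at this
    exact squeeze_zero (fun n => (hLpos n).le) hLle this
  have hball : ∀ n, ∀ y ∈ Ioo (0 : ℝ) 1,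
      mob (Mn n x) y ∈ Metric.closedBall (w n) (L n / 2) := by
    intro n y hy
    have dy := Mn_den_pos hx n (Ioo_subset_Icc_self hy)
    have d0 := Mn_den_pos hx n (y := 0) (by simp)
    have d1 := Mn_den_pos hx n (y := 1) (by simp)
    have e0 := mob_sub (Mn n x) dy d0
    have e1 := mob_sub (Mn n x) d1 dy
    have e2 := mob_sub (Mn n x) d1 d0
    have hdet := (Mn_facts hx n).2.2.2
    have hLn : L n = |mob (Mn n x) 1 - mob (Mn n x) 0| := by
      rw [e2, abs_div, abs_mul, hdet, abs_of_pos (mul_pos d1 d0)]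
      simp only [hL]
      norm_num
      ring
    have huv : 0 ≤ (mob (Mn n x) y - mob (Mn n x) 0) * (mob (Mn n x) 1 - mob (Mn n x) y) := by
      rw [e0, e1, div_mul_div_comm]
      apply div_nonneg _ (by positivity)
      have : 0 ≤ (Mn n x).det ^ 2 * ((y - 0) * (1 - y)) := by
        apply mul_nonneg (sq_nonneg _) (mul_nonneg _ _) <;> linarith [hy.1, hy.2]
      linarith
    rw [Metric.mem_closedBall, Real.dist_eq, hLn]
    simp only [hw]
    have : |2 * (mob (Mn n x) y - (mob (Mn n x) 0 + mob (Mn n x) 1) / 2)|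
        ≤ |mob (Mn n x) 1 - mob (Mn n x) 0| := by
      apply sq_le_sq.1
      nlinarith
    rw [abs_mul, abs_two] at this
    linarith
  have hlim := hx1 (l := atTop) w (fun n => L n / 2) (by
    rw [tendsto_nhdsWithin_iff]
    refine ⟨by simpa using hLlim.div_const 2, Eventually.of_forall fun n => ?_⟩
    exact half_pos (hLpos n)) (Eventually.of_forall fun n => by
      rw [one_mul]
      have := hball n _ (good_iter hx n).1
      rwa [mob_T_iter hx n] at this)
  have hiter : ∀ n, (T^[n]) ⁻¹' S = S := by
    intro n
    induction n with
    | zero => rfl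
    | succ n ih => rw [Function.iterate_succ', preimage_comp, hinv, ih]
  have hc1 : volume S1 / 16 ≠ 0 := by
    simp [ENNReal.div_eq_zero_iff, h1]
  have hbound : ∀ n, volume (S0 ∩ Metric.closedBall (w n) (L n / 2)) /
      volume (Metric.closedBall (w n) (L n / 2)) ≤ 1 - volume S1 / 16 := by
    intro n
    set B := Metric.closedBall (w n) (L n / 2) with hB
    have hBvol : volume B = ENNReal.ofReal (L n) := by
      rw [hB, Real.volume_closedBall]; congr 1; ring
    set J := mob (Mn n x) '' S1 with hJ
    have hder : ∀ y ∈ S1, HasDerivWithinAt (mob (Mn n x))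
        ((Mn n x).det / (Mn n x 1 0 * y + Mn n x 1 1) ^ 2) S1 y := fun y hy =>
      (mob_deriv _ (Mn_den_pos hx n (Ioo_subset_Icc_self hy.2)).ne').hasDerivWithinAt
    have hinj : InjOn (mob (Mn n x)) S1 := by
      intro y hy z hz h
      rw [← (T_iter_mob hx n hy.2).1, ← (T_iter_mob hx n hz.2).1, h]
    have hJvol : volume S1 / 16 * volume B ≤ volume J := by
      have e := lintegral_image_eq_lintegral_abs_deriv_mul hS1m hder hinj (fun _ => 1)
      simp only [lintegral_const, one_mul, mul_one, Measure.restrict_apply MeasurableSet.univ,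
        univ_inter] at e
      rw [hJ, e]
      have e2 : volume S1 / 16 * volume B = ∫⁻ y in S1, ENNReal.ofReal (L n / 16) := by
        have h16 : ENNReal.ofReal (L n / 16) = ENNReal.ofReal (L n) / 16 := by
          rw [ENNReal.ofReal_div_of_pos (by norm_num)]
          congr 1
          exact ENNReal.ofReal_ofNat 16
        rw [lintegral_const, Measure.restrict_apply MeasurableSet.univ, univ_inter, hBvol, h16]
        rw [div_eq_mul_inv, div_eq_mul_inv]
        ring
      rw [e2]
      refine setLIntegral_mono' hS1m fun y hy => ENNReal.ofReal_le_ofReal ?_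
      have dy := Mn_den_pos hx n (Ioo_subset_Icc_self hy.2)
      have dy2 := (Mn_den hx n (Ioo_subset_Icc_self hy.2)).2
      have r2 := sq3_hi
      rw [abs_div, (Mn_facts hx n).2.2.2, abs_of_pos (by positivity)]
      simp only [hL]
      have hDn := hD n
      have hEn := hE n
      have hEn' := hE' n
      rw [div_div, div_le_div_iff₀ (by positivity) (by positivity)]
      have h3 : Mn n x 1 0 * y + Mn n x 1 1 ≤ 3 * Mn n x 1 1 := by nlinarith
      have h4 : (Mn n x 1 0 * y + Mn n x 1 1) ^ 2 ≤ (3 * Mn n x 1 1) ^ 2 := by gcongr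
      nlinarith
    have hJm : MeasurableSet J := by
      apply measurable_image_of_fderivWithin hS1m
        (fun y hy => (hder y hy).hasFDerivWithinAt) hinj
    have hdisj : Disjoint (S0 ∩ B) J := by
      rw [Set.disjoint_left]
      rintro _ ⟨⟨hz, -⟩, -⟩ ⟨y, hy, rfl⟩
      rw [← hiter n] at hz
      apply hy.1
      have : T^[n] (mob (Mn n x) y) ∈ S := hz
      rwa [(T_iter_mob hx n hy.2).1] at this
    have hsub : S0 ∩ B ∪ J ⊆ B := by
      rintro z (hz | ⟨y, hy, rfl⟩)
      · exact hz.2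
      · exact hball n y hy.2
    have hsum : volume (S0 ∩ B) + volume J ≤ volume B := by
      rw [← measure_union hdisj hJm]
      exact measure_mono hsub
    apply ENNReal.div_le_of_le_mul
    have hBfin : volume B ≠ ⊤ := by rw [hBvol]; exact ENNReal.ofReal_ne_top
    rw [ENNReal.sub_mul (fun _ _ => hBfin), one_mul]
    apply ENNReal.le_sub_of_add_le_right
    · exact ENNReal.mul_ne_top (ENNReal.div_ne_top hS1fin (by norm_num)) hBfin
    · exact le_trans (by gcongr) hsum
  have hfin := le_of_tendsto' hlim hbound
  have : (1 : ENNReal) - volume S1 / 16 < 1 := ENNReal.sub_lt_self (by simp) (by simp) hc1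
  exact absurd hfin (not_le.2 this)


lemma logpos : 0 < Real.log (2 + √3) := Real.log_pos (by linarith [sq3_lo])

lemma fdens_pos {x : ℝ} (hx : x ∈ Icc (0 : ℝ) 1) : 0 < fdens x := by
  have r1 := sq3_lo
  have r2 := sq3_hi
  have := logpos
  obtain ⟨h0, h1⟩ := hx
  unfold fdens
  have e1 : 0 < 1 - (2 - √3) * x := by nlinarith
  have e2 : 0 < 1 + √3 * x := by positivity
  positivity

lemma fdens_measurable : Measurable fdens := by unfold fdens; fun_prop

lemma fdens_div {num den : ℝ} (hden : 0 < den) (hA : 0 < den - (2 - √3) * num)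
    (hB : 0 < den + √3 * num) :
    1 / den ^ 2 * fdens (num / den) =
      1 / Real.log (2 + √3) * (2 / ((den - (2 - √3) * num) * (den + √3 * num))) := by
  have hl := logpos
  unfold fdens
  have e1 : 1 - (2 - √3) * (num / den) = (den - (2 - √3) * num) / den := by
    field_simp
  have e2 : 1 + √3 * (num / den) = (den + √3 * num) / den := by field_simp
  rw [e1, e2]
  set A := den - (2 - √3) * num
  set B := den + √3 * num
  field_simp

/-- transfer-operator weight of a digit -/
noncomputable def wt (d : Digit) (y : ℝ) : ℝ :=
  1 / (Mdig d 1 0 * y + Mdig d 1 1) ^ 2 * fdens (mob (Mdig d) y)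

/-- telescoping primitive -/
noncomputable def Fc (y : ℝ) (N : ℝ) : ℝ :=
  -(1 / (2 * N + y + √3)) - 1 / (2 * N + 2 + √3 - y)
  + (N + (√3 + 1) / 2) / ((N + (√3 + 1) / 2) + 1 + (N + (√3 + 1) / 2) * y)
  - (N + (√3 + 3) / 2) / ((N + (√3 + 3) / 2) - 1 + (N + (√3 + 3) / 2) * y)

lemma wt_ep (n : ℕ) {y : ℝ} (hy : y ∈ Ioo (0 : ℝ) 1) : wt ⟨n + 1, 1, Par.e⟩ y =
    1 / Real.log (2 + √3) * (1 / (2 * n + y + √3) - 1 / (2 * (n + 1) + y + √3)) := by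
  have r1 := sq3_lo
  have hn : (0 : ℝ) ≤ n := by positivity
  obtain ⟨y0, y1⟩ := hy
  unfold wt mob
  rw [Mdig_ep]
  simp only [Matrix.of_apply, Matrix.cons_val', Matrix.cons_val_zero, Matrix.cons_val_one,
    Matrix.cons_val_fin_one]
  push_cast
  rw [fdens_div (by positivity) (by linarith) (by linarith)]
  congr 1
  have h1 : 0 < 2 * n + y + √3 := by positivity
  have h2 : 0 < 2 * (n + 1) + y + √3 := by positivity
  rw [div_sub_div _ _ h1.ne' h2.ne']
  congr 1 <;> ring

lemma wt_em (n : ℕ) {y : ℝ} (hy : y ∈ Ioo (0 : ℝ) 1) : wt ⟨n + 2, -1, Par.e⟩ y =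
    1 / Real.log (2 + √3) * (1 / (2 * n + 2 + √3 - y) - 1 / (2 * (n + 1) + 2 + √3 - y)) := by
  have r1 := sq3_lo
  have hn : (0 : ℝ) ≤ n := by positivity
  obtain ⟨y0, y1⟩ := hy
  unfold wt mob
  rw [Mdig_em]
  simp only [Matrix.of_apply, Matrix.cons_val', Matrix.cons_val_zero, Matrix.cons_val_one,
    Matrix.cons_val_fin_one]
  push_cast
  rw [fdens_div (by linarith) (by linarith) (by linarith)]
  congr 1
  have h1 : 0 < 2 * n + 2 + √3 - y := by linarith
  have h2 : 0 < 2 * (n + 1) + 2 + √3 - y := by linarith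
  rw [div_sub_div _ _ h1.ne' h2.ne']
  congr 1 <;> ring

lemma wt_op (n : ℕ) {y : ℝ} (hy : y ∈ Ioo (0 : ℝ) 1) (u : ℝ) (hu : u = n + (√3 + 1) / 2) :
    wt ⟨n + 2, 1, Par.o⟩ y =
    1 / Real.log (2 + √3) * ((u + 1) / (u + 1 + 1 + (u + 1) * y) - u / (u + 1 + u * y)) := by
  have r1 := sq3_lo
  have r2 := sq3
  have hn : (0 : ℝ) ≤ n := by positivity
  have hup : 0 < u := by rw [hu]; positivity
  obtain ⟨y0, y1⟩ := hy
  unfold wt mob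
  rw [Mdig_op]
  simp only [Matrix.of_apply, Matrix.cons_val', Matrix.cons_val_zero, Matrix.cons_val_one,
    Matrix.cons_val_fin_one]
  push_cast
  have eA : ((n : ℝ) + 2) * y + (n + 2 + 1) - (2 - √3) * ((n + 2 - 1) * y + (n + 2))
      = (√3 - 1) * (u + 1 + 1 + (u + 1) * y) := by
    rw [hu]; linear_combination (-(y + 1) / 2) * r2
  have eB : ((n : ℝ) + 2) * y + (n + 2 + 1) + √3 * ((n + 2 - 1) * y + (n + 2))
      = (√3 + 1) * (u + 1 + u * y) := by
    rw [hu]; linear_combination (-(y + 1) / 2) * r2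
  have h1 : 0 < u + 1 + 1 + (u + 1) * y := by positivity
  have h2 : 0 < u + 1 + u * y := by positivity
  have h3 : 0 < √3 - 1 := by linarith
  rw [fdens_div (by positivity) (by rw [eA]; positivity) (by rw [eB]; positivity), eA, eB]
  congr 1
  rw [div_sub_div _ _ h1.ne' h2.ne', div_eq_div_iff (by positivity) (by positivity)]
  linear_combination (-(u + 1 + 1 + (u + 1) * y) * (u + 1 + u * y)) * r2

lemma wt_om (n : ℕ) {y : ℝ} (hy : y ∈ Ioo (0 : ℝ) 1) (u : ℝ) (hu : u = n + (√3 + 3) / 2) :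
    wt ⟨n + 2, -1, Par.o⟩ y =
    1 / Real.log (2 + √3) * (u / (u - 1 + u * y) - (u + 1) / (u + 1 - 1 + (u + 1) * y)) := by
  have r1 := sq3_lo
  have r2 := sq3
  have hn : (0 : ℝ) ≤ n := by positivity
  have hup : 1 < u := by rw [hu]; linarith
  obtain ⟨y0, y1⟩ := hy
  unfold wt mob
  rw [Mdig_om]
  simp only [Matrix.of_apply, Matrix.cons_val', Matrix.cons_val_zero, Matrix.cons_val_one,
    Matrix.cons_val_fin_one]
  push_cast
  have eA : ((n : ℝ) + 2 + 1) * y + (n + 2) - (2 - √3) * ((n + 2) * y + (n + 2 - 1))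
      = (√3 - 1) * (u + 1 - 1 + (u + 1) * y) := by
    rw [hu]; linear_combination (-(y + 1) / 2) * r2
  have eB : ((n : ℝ) + 2 + 1) * y + (n + 2) + √3 * ((n + 2) * y + (n + 2 - 1))
      = (√3 + 1) * (u - 1 + u * y) := by
    rw [hu]; linear_combination (-(y + 1) / 2) * r2
  have h1 : 0 < u + 1 - 1 + (u + 1) * y := by
    have : 0 < (u + 1) * y := by positivity
    linarith
  have h2 : 0 < u - 1 + u * y := by
    have : 0 < u * y := by positivity
    linarith
  have h3 : 0 < √3 - 1 := by linarith
  rw [fdens_div (by positivity) (by rw [eA]; positivity) (by rw [eB]; positivity), eA, eB]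
  congr 1
  rw [div_sub_div _ _ h2.ne' h1.ne', div_eq_div_iff (by positivity) (by positivity)]
  linear_combination (-(u + 1 - 1 + (u + 1) * y) * (u - 1 + u * y)) * r2

/-- sum of the four weights with index `n` -/
noncomputable def wt4 (n : ℕ) (y : ℝ) : ℝ :=
  wt ⟨n + 1, 1, Par.e⟩ y + wt ⟨n + 2, -1, Par.e⟩ y + wt ⟨n + 2, 1, Par.o⟩ y
    + wt ⟨n + 2, -1, Par.o⟩ y

lemma wt4_eq (n : ℕ) {y : ℝ} (hy : y ∈ Ioo (0 : ℝ) 1) :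
    wt4 n y = 1 / Real.log (2 + √3) * (Fc y ((n + 1 : ℕ) : ℝ) - Fc y n) := by
  unfold wt4 Fc
  rw [wt_ep n hy, wt_em n hy, wt_op n hy _ rfl, wt_om n hy _ rfl]
  push_cast
  rw [show (n : ℝ) + 1 + (√3 + 1) / 2 = n + (√3 + 1) / 2 + 1 by ring,
    show (n : ℝ) + 1 + (√3 + 3) / 2 = n + (√3 + 3) / 2 + 1 by ring]
  ring

lemma Fc_le (n : ℕ) {y : ℝ} (hy : y ∈ Ioo (0 : ℝ) 1) : Fc y n ≤ 0 := by
  have r1 := sq3_lo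
  have hn : (0 : ℝ) ≤ n := by positivity
  obtain ⟨y0, y1⟩ := hy
  unfold Fc
  have h1 : 0 < 2 * (n : ℝ) + y + √3 := by positivity
  have h2 : 0 < 2 * (n : ℝ) + 2 + √3 - y := by linarith
  have a1 : (n + (√3 + 1) / 2) / ((n + (√3 + 1) / 2) + 1 + (n + (√3 + 1) / 2) * y)
      ≤ 1 / (1 + y) := by
    set u := (n : ℝ) + (√3 + 1) / 2
    have hu : 0 < u := by positivity
    rw [div_le_div_iff₀ (by positivity) (by positivity)]
    linarith
  have a2 : 1 / (1 + y) ≤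
      (n + (√3 + 3) / 2) / ((n + (√3 + 3) / 2) - 1 + (n + (√3 + 3) / 2) * y) := by
    obtain ⟨u, hu⟩ : ∃ u, u = (n : ℝ) + (√3 + 3) / 2 := ⟨_, rfl⟩
    rw [← hu]
    have hu1 : 1 < u := by rw [hu]; linarith
    have : 0 < u * y := by positivity
    rw [div_le_div_iff₀ (by positivity) (by linarith)]
    linarith
  have b1 : 0 < 1 / (2 * (n : ℝ) + y + √3) := by positivity
  have b2 : 0 < 1 / (2 * (n : ℝ) + 2 + √3 - y) := by positivity
  linarith

lemma Fc_zero {y : ℝ} (hy : y ∈ Ioo (0 : ℝ) 1) :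
    1 / Real.log (2 + √3) * (-Fc y 0) = fdens y := by
  have r1 := sq3_lo
  have r2 := sq3
  have r3 := sq3_hi
  obtain ⟨y0, y1⟩ := hy
  have hl := logpos
  have k1 : ((0 : ℝ) + (√3 + 1) / 2) / ((0 + (√3 + 1) / 2) + 1 + (0 + (√3 + 1) / 2) * y)
      = 1 / (√3 + y) := by
    rw [div_eq_div_iff (by positivity) (by positivity)]
    linear_combination (1 / 2) * r2
  have hu : 0 < ((0 : ℝ) + (√3 + 3) / 2) - 1 + (0 + (√3 + 3) / 2) * y := by
    have : 0 < ((0 : ℝ) + (√3 + 3) / 2) * y := by positivity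
    linarith
  have k2 : ((0 : ℝ) + (√3 + 3) / 2) / ((0 + (√3 + 3) / 2) - 1 + (0 + (√3 + 3) / 2) * y)
      = √3 / (1 + √3 * y) := by
    rw [div_eq_div_iff hu.ne' (by positivity)]
    linear_combination (-1 / 2) * r2
  have hA : 0 < 1 - (2 - √3) * y := by nlinarith
  have hB : 0 < 1 + √3 * y := by positivity
  have k3 : 1 / (2 * 0 + 2 + √3 - y) = (2 - √3) / (1 - (2 - √3) * y) := by
    rw [div_eq_div_iff (by linarith) hA.ne']
    linear_combination r2
  unfold Fc fdens
  rw [k1, k2, k3]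
  have e : -(-(1 / (2 * 0 + y + √3)) - (2 - √3) / (1 - (2 - √3) * y) + 1 / (√3 + y)
      - √3 / (1 + √3 * y)) = (2 - √3) / (1 - (2 - √3) * y) + √3 / (1 + √3 * y) := by
    rw [show 2 * 0 + y + √3 = √3 + y by ring]; ring
  rw [e, div_add_div _ _ hA.ne' hB.ne', div_mul_div_comm, div_eq_div_iff (by positivity)
    (by positivity)]
  ring

lemma wt_nonneg {d : Digit} (hd : d.Valid) {y : ℝ} (hy : y ∈ Ioo (0 : ℝ) 1) : 0 ≤ wt d y := by
  have h := (mob_facts hd hy).2.1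
  have := fdens_pos (Ioo_subset_Icc_self h)
  unfold wt; positivity

lemma valid_ep (n : ℕ) : (⟨n + 1, 1, Par.e⟩ : Digit).Valid := by
  unfold Digit.Valid
  rcases Nat.eq_zero_or_pos n with h | h
  · right; simp [h]
  · left; exact ⟨by simp only; omega, Or.inl rfl⟩
lemma valid_em (n : ℕ) : (⟨n + 2, -1, Par.e⟩ : Digit).Valid :=
  Or.inl ⟨by simp only; omega, Or.inr rfl⟩
lemma valid_op (n : ℕ) : (⟨n + 2, 1, Par.o⟩ : Digit).Valid :=
  Or.inl ⟨by simp only; omega, Or.inl rfl⟩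
lemma valid_om (n : ℕ) : (⟨n + 2, -1, Par.o⟩ : Digit).Valid :=
  Or.inl ⟨by simp only; omega, Or.inr rfl⟩

lemma tsum_wt_le {y : ℝ} (hy : y ∈ Ioo (0 : ℝ) 1) :
    ∑' n : ℕ, (ENNReal.ofReal (wt ⟨n + 1, 1, Par.e⟩ y) + ENNReal.ofReal (wt ⟨n + 2, -1, Par.e⟩ y)
      + ENNReal.ofReal (wt ⟨n + 2, 1, Par.o⟩ y) + ENNReal.ofReal (wt ⟨n + 2, -1, Par.o⟩ y))
      ≤ ENNReal.ofReal (fdens y) := by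
  have hterm : ∀ n : ℕ, ENNReal.ofReal (wt ⟨n + 1, 1, Par.e⟩ y)
      + ENNReal.ofReal (wt ⟨n + 2, -1, Par.e⟩ y)
      + ENNReal.ofReal (wt ⟨n + 2, 1, Par.o⟩ y) + ENNReal.ofReal (wt ⟨n + 2, -1, Par.o⟩ y)
      = ENNReal.ofReal (wt4 n y) := by
    intro n
    have h1 := wt_nonneg (valid_ep n) hy
    have h2 := wt_nonneg (valid_em n) hy
    have h3 := wt_nonneg (valid_op n) hy
    have h4 := wt_nonneg (valid_om n) hy
    unfold wt4
    rw [ENNReal.ofReal_add (by positivity) h4, ENNReal.ofReal_add (by positivity) h3,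
      ENNReal.ofReal_add h1 h2]
  rw [tsum_congr hterm]
  have hl := logpos
  refine ENNReal.tsum_le_of_sum_range_le fun N => ?_
  rw [← ENNReal.ofReal_sum_of_nonneg]
  · apply ENNReal.ofReal_le_ofReal
    rw [Finset.sum_congr rfl fun n _ => wt4_eq n hy, ← Finset.mul_sum,
      Finset.sum_range_sub (fun n : ℕ => Fc y n), ← Fc_zero hy]
    apply mul_le_mul_of_nonneg_left _ (by positivity)
    have := Fc_le N hy
    push_cast
    linarith
  · intro n _
    have h1 := wt_nonneg (valid_ep n) hy
    have h2 := wt_nonneg (valid_em n) hy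
    have h3 := wt_nonneg (valid_op n) hy
    have h4 := wt_nonneg (valid_om n) hy
    unfold wt4
    positivity


lemma mob_measurable (M : Matrix (Fin 2) (Fin 2) ℝ) : Measurable (mob M) := by
  unfold mob; fun_prop

lemma wt_measurable (d : Digit) : Measurable (wt d) := by
  unfold wt
  exact Measurable.mul (by fun_prop) (fdens_measurable.comp (mob_measurable _))

lemma lintegral_branch {d : Digit} (hd : d.Valid) {s : Set ℝ} (hs : MeasurableSet s) :
    ∫⁻ x in mob (Mdig d) '' (s ∩ Ioo 0 1), ENNReal.ofReal (fdens x)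
      = ∫⁻ y in s ∩ Ioo 0 1, ENNReal.ofReal (wt d y) := by
  have hm : MeasurableSet (s ∩ Ioo (0 : ℝ) 1) := hs.inter measurableSet_Ioo
  rw [lintegral_image_eq_lintegral_abs_deriv_mul hm
    (f' := fun y => (Mdig d).det / (Mdig d 1 0 * y + Mdig d 1 1) ^ 2)
    (fun y hy => (mob_deriv _ (mob_facts hd hy.2).1.ne').hasDerivWithinAt)]
  · refine setLIntegral_congr_fun hm fun y hy => ?_
    rw [← ENNReal.ofReal_mul (abs_nonneg _), abs_div, Mdig_det hd,
      abs_of_nonneg (sq_nonneg (Mdig d 1 0 * y + Mdig d 1 1))]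
    rfl
  · intro y hy z hz h
    rw [← (mob_facts hd hy.2).2.2.1, ← (mob_facts hd hz.2).2.2.1, h]

lemma mu_apply {s : Set ℝ} (hs : MeasurableSet s) :
    mu s = ∫⁻ x in s ∩ Ioo 0 1, ENNReal.ofReal (fdens x) := by
  unfold mu
  rw [withDensity_apply _ hs, Measure.restrict_restrict hs]

lemma mu_preimage_le {s : Set ℝ} (hs : MeasurableSet s) : mu (T ⁻¹' s) ≤ mu s := by
  rw [mu_apply hs, mu_apply (T_measurable hs)]
  set I := fun d : Digit => mob (Mdig d) '' (s ∩ Ioo 0 1) with hI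
  have hsub : T ⁻¹' s ∩ Ioo 0 1 ⊆ {x | ¬ Irrational x} ∪ ⋃ n : ℕ,
      (I ⟨n + 1, 1, Par.e⟩ ∪ I ⟨n + 2, -1, Par.e⟩ ∪ I ⟨n + 2, 1, Par.o⟩ ∪ I ⟨n + 2, -1, Par.o⟩) := by
    rintro x ⟨hxs, hx⟩
    by_cases hi : Irrational x
    · right
      obtain ⟨h1, h2, h3, -⟩ := good_step (x := x) ⟨hx, hi⟩
      have hmem : x ∈ I (digit x) := ⟨T x, ⟨hxs, h2.1⟩, h3⟩
      rw [mem_iUnion]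
      rcases valid_cases h1 with ⟨n, h⟩ | ⟨n, h⟩ | ⟨n, h⟩ | ⟨n, h⟩ <;> rw [h] at hmem <;>
        refine ⟨n, ?_⟩ <;> simp only [mem_union] <;> tauto
    · left; exact hi
  refine (lintegral_mono_set hsub).trans ?_
  refine (lintegral_union_le _ _ _).trans ?_
  rw [setLIntegral_measure_zero _ _ rat_null, zero_add]
  refine (lintegral_iUnion_le _ _).trans ?_
  calc _ ≤ ∑' n : ℕ, ∫⁻ y in s ∩ Ioo 0 1, (ENNReal.ofReal (wt ⟨n + 1, 1, Par.e⟩ y)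
      + ENNReal.ofReal (wt ⟨n + 2, -1, Par.e⟩ y)
      + ENNReal.ofReal (wt ⟨n + 2, 1, Par.o⟩ y) + ENNReal.ofReal (wt ⟨n + 2, -1, Par.o⟩ y)) := by
        refine ENNReal.tsum_le_tsum fun n => ?_
        rw [lintegral_add_right _ (wt_measurable _).ennreal_ofReal,
          lintegral_add_right _ (wt_measurable _).ennreal_ofReal,
          lintegral_add_right _ (wt_measurable _).ennreal_ofReal,
          ← lintegral_branch (valid_ep n) hs, ← lintegral_branch (valid_em n) hs,
          ← lintegral_branch (valid_op n) hs, ← lintegral_branch (valid_om n) hs]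
        refine (lintegral_union_le _ _ _).trans ?_
        gcongr
        refine (lintegral_union_le _ _ _).trans ?_
        gcongr
        exact lintegral_union_le _ _ _
    _ = ∫⁻ y in s ∩ Ioo 0 1, ∑' n : ℕ, (ENNReal.ofReal (wt ⟨n + 1, 1, Par.e⟩ y)
      + ENNReal.ofReal (wt ⟨n + 2, -1, Par.e⟩ y)
      + ENNReal.ofReal (wt ⟨n + 2, 1, Par.o⟩ y) + ENNReal.ofReal (wt ⟨n + 2, -1, Par.o⟩ y)) := by
        rw [lintegral_tsum]
        intro n
        exact (((wt_measurable _).ennreal_ofReal.add (wt_measurable _).ennreal_ofReal).add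
          (wt_measurable _).ennreal_ofReal).add (wt_measurable _).ennreal_ofReal |>.aemeasurable
    _ ≤ _ := setLIntegral_mono' (hs.inter measurableSet_Ioo) fun y hy => tsum_wt_le hy.2

/-- primitive of the density -/
noncomputable def prim (x : ℝ) : ℝ :=
  1 / Real.log (2 + √3) * (Real.log (1 + √3 * x) - Real.log (1 - (2 - √3) * x))

lemma prim_deriv {x : ℝ} (hx : x ∈ Icc (0 : ℝ) 1) : HasDerivAt prim (fdens x) x := by
  have h1 := sq3_lo
  have h2 := sq3_hi
  have hl := logpos
  have hA : 0 < 1 + √3 * x := by have := hx.1; positivity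
  have hB : 0 < 1 - (2 - √3) * x := by nlinarith [hx.1, hx.2]
  have d1 : HasDerivAt (fun x => 1 + √3 * x) √3 x := by
    simpa using ((hasDerivAt_id x).const_mul √3).const_add 1
  have d2 : HasDerivAt (fun x => 1 - (2 - √3) * x) (-(2 - √3)) x := by
    simpa using ((hasDerivAt_id x).const_mul (2 - √3)).const_sub 1
  refine (((d1.log hA.ne').sub (d2.log hB.ne')).const_mul (1 / Real.log (2 + √3))).congr_deriv ?_
  unfold fdens
  set L := Real.log (2 + √3)
  have hA' := hA.ne'
  have hB' := hB.ne'
  set B := 1 - (2 - √3) * x with hBd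
  set A := 1 + √3 * x with hAd
  field_simp
  rw [hBd, hAd]; ring

lemma fdens_cont : ContinuousOn fdens (Icc 0 1) := by
  intro x hx
  have h1 := sq3_lo
  have h2 := sq3_hi
  have hl := logpos
  have hA : 0 < 1 + √3 * x := by have := hx.1; positivity
  have hB : 0 < 1 - (2 - √3) * x := by nlinarith [hx.1, hx.2]
  apply ContinuousAt.continuousWithinAt
  unfold fdens
  apply ContinuousAt.div (by fun_prop) (by fun_prop)
  positivity

lemma mu_prob : mu univ = 1 := by
  rw [mu_apply MeasurableSet.univ, univ_inter]
  have hint : IntervalIntegrable fdens volume 0 1 := by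
    apply ContinuousOn.intervalIntegrable
    rw [uIcc_of_le zero_le_one]; exact fdens_cont
  rw [← ofReal_integral_eq_lintegral_ofReal]
  · rw [← integral_Ioc_eq_integral_Ioo, ← intervalIntegral.integral_of_le zero_le_one,
      intervalIntegral.integral_eq_sub_of_hasDerivAt (f := prim) _ hint]
    · have hl := logpos
      have h1 := sq3_lo
      have h2 := sq3_hi
      unfold prim
      simp only [mul_one, mul_zero, add_zero, sub_zero, Real.log_one]
      rw [← Real.log_div (by positivity) (by linarith)]
      have : (1 + √3) / (1 - (2 - √3)) = 2 + √3 := by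
        rw [div_eq_iff (by linarith)]; nlinarith [sq3]
      rw [this, one_div, inv_mul_cancel₀ hl.ne']; simp
    · intro x hx
      rw [uIcc_of_le zero_le_one] at hx
      exact prim_deriv hx
  · rw [intervalIntegrable_iff_integrableOn_Ioo_of_le zero_le_one] at hint
    exact hint
  · filter_upwards [ae_restrict_mem measurableSet_Ioo] with x hx
    exact (fdens_pos (Ioo_subset_Icc_self hx)).le

instance mu_isProb : IsProbabilityMeasure mu := ⟨mu_prob⟩

lemma T_mp : MeasurePreserving T mu mu := by
  refine ⟨T_measurable, ?_⟩
  ext s hs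
  rw [Measure.map_apply T_measurable hs]
  refine le_antisymm (mu_preimage_le hs) ?_
  have h := mu_preimage_le hs.compl
  rw [preimage_compl, prob_compl_eq_one_sub (T_measurable hs), prob_compl_eq_one_sub hs] at h
  have h3 : 1 - (1 - mu (T ⁻¹' s)) = mu (T ⁻¹' s) :=
    ENNReal.sub_sub_cancel ENNReal.one_ne_top prob_le_one
  have h4 : 1 - (1 - mu s) = mu s :=
    ENNReal.sub_sub_cancel ENNReal.one_ne_top prob_le_one
  rw [← h3, ← h4]
  exact tsub_le_tsub_left h 1

lemma mu_ac : mu ≪ volume.restrict (Ioo (0 : ℝ) 1) := withDensity_absolutelyContinuous _ _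

lemma ac_mu : volume.restrict (Ioo (0 : ℝ) 1) ≪ mu := by
  apply withDensity_absolutelyContinuous' fdens_measurable.ennreal_ofReal.aemeasurable
  filter_upwards [ae_restrict_mem measurableSet_Ioo] with x hx
  have := fdens_pos (Ioo_subset_Icc_self hx)
  simpa using this

lemma T_ergodic : Ergodic T mu := by
  refine { T_mp with aeconst_set := fun s hs hinv => ?_ }
  rw [eventuallyConst_set']
  rcases invariant_dichotomy hs hinv with h | h
  · left
    rw [ae_eq_empty]
    apply mu_ac
    rwa [Measure.restrict_apply hs]
  · right
    rw [ae_eq_univ]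
    apply mu_ac
    rwa [Measure.restrict_apply hs.compl]


lemma mu_good : ∀ᵐ x ∂mu, x ∈ Good := mu_ac.ae_le ae_good

lemma integrable_mu {F : ℝ → ℝ} (h : IntegrableOn F (Ioo 0 1)) : Integrable F mu := by
  obtain ⟨C, hC⟩ := isCompact_Icc.exists_bound_of_continuousOn fdens_cont
  have hle : mu ≤ ENNReal.ofReal C • volume.restrict (Ioo (0 : ℝ) 1) := by
    rw [← withDensity_const]
    apply withDensity_mono
    filter_upwards [ae_restrict_mem measurableSet_Ioo] with x hx
    exact ENNReal.ofReal_le_ofReal ((le_abs_self _).trans (hC x (Ioo_subset_Icc_self hx)))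
  exact (h.smul_measure ENNReal.ofReal_ne_top).mono_measure hle

/-- integrable majorant -/
noncomputable def major (x : ℝ) : ℝ := 2 * |Real.log x| + 2 * |Real.log (1 - x)| + 2

lemma major_int : Integrable major mu := by
  apply integrable_mu
  have h1 : IntervalIntegrable Real.log volume 0 1 := intervalIntegral.intervalIntegrable_log'
  have h2 : IntervalIntegrable (fun x => Real.log (1 - x)) volume 0 1 := by
    have := (h1.comp_sub_left 1).symm
    simpa using this
  rw [intervalIntegrable_iff_integrableOn_Ioo_of_le zero_le_one] at h1 h2
  have h3 : IntegrableOn (fun _ : ℝ => (2 : ℝ)) (Ioo 0 1) := by simp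
  exact ((h1.abs.const_mul 2).add (h2.abs.const_mul 2)).add h3

lemma jac_measurable : Measurable jac := by
  have := T_measurable
  unfold jac
  exact Measurable.ite measurableSet_Iic (by fun_prop) (by fun_prop)

lemma phi_measurable : Measurable phi := by
  have := jac_measurable
  unfold phi
  fun_prop

/-- transfer function of the coboundary -/
noncomputable def gg (x : ℝ) : ℝ := if x ≤ 1 / 2 then x ^ 2 else (1 - x) ^ 2 / 2

lemma gg_measurable : Measurable gg := by
  unfold gg
  exact Measurable.ite measurableSet_Iic (by fun_prop) (by fun_prop)

lemma log2_lt : Real.log 2 < 1 := by linarith [Real.log_two_lt_d9]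

lemma log2_pos : 0 < Real.log 2 := Real.log_pos (by norm_num)

lemma phi_int : Integrable phi mu := by
  refine major_int.mono' phi_measurable.aestronglyMeasurable ?_
  filter_upwards [mu_good] with x hx
  obtain ⟨-, hT, -⟩ := good_step hx
  have h2 := log2_lt
  have a1 := abs_nonneg (Real.log x)
  have a2 := abs_nonneg (Real.log (1 - x))
  unfold phi jac major
  rw [Real.norm_eq_abs, abs_mul, abs_two]
  split_ifs with h
  · rw [one_div, Real.log_inv, abs_neg]; linarith
  · have hx1 : 0 < 1 - x := by linarith [hx.1.2]
    have ht : 0 < T x := hT.1.1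
    rw [Real.log_div (by positivity) hx1.ne']
    have b0 : 0 ≤ Real.log (1 + T x) := Real.log_nonneg (by linarith)
    have b1 : Real.log (1 + T x) ≤ Real.log 2 :=
      Real.log_le_log (by positivity) (by linarith [hT.1.2])
    have := abs_sub (Real.log (1 + T x)) (Real.log (1 - x))
    rw [abs_of_nonneg b0] at this
    linarith

lemma loggg_int : Integrable (fun x => Real.log (gg x)) mu := by
  refine major_int.mono' (gg_measurable.log).aestronglyMeasurable ?_
  filter_upwards [mu_good] with x hx
  have h2 := log2_lt
  have a1 := abs_nonneg (Real.log x)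
  have a2 := abs_nonneg (Real.log (1 - x))
  unfold gg major
  rw [Real.norm_eq_abs]
  split_ifs with h
  · rw [Real.log_pow, abs_mul]; norm_num; linarith
  · have hx1 : 0 < 1 - x := by linarith [hx.1.2]
    rw [Real.log_div (by positivity) (by norm_num), Real.log_pow]
    have := abs_sub ((2 : ℕ) * Real.log (1 - x)) (Real.log 2)
    rw [abs_of_pos log2_pos, abs_mul] at this
    norm_num at this ⊢
    linarith

lemma log_fPiece {x : ℝ} (hx : x ∈ Good) :
    Real.log (fPiece x) = phi x + Real.log (gg x) - Real.log (gg (T x)) := by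
  obtain ⟨-, hT, -⟩ := good_step hx
  have t0 : 0 < T x := hT.1.1
  have t1 : 0 < 1 - T x := by linarith [hT.1.2]
  have x0 : 0 < x := hx.1.1
  have x1 : 0 < 1 - x := by linarith [hx.1.2]
  have t2 : 0 < 1 + T x := by linarith
  unfold fPiece phi jac gg
  split_ifs with h1 h2 h2
  · rw [one_div, one_div, Real.log_inv, Real.log_inv, Real.log_pow, Real.log_pow]
    push_cast; ring
  · rw [one_div, Real.log_inv, Real.log_div (by positivity) (by positivity),
      Real.log_div (by positivity) (by positivity), Real.log_pow, Real.log_pow]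
    push_cast; ring
  · rw [Real.log_div (by positivity) (by positivity), Real.log_div (by positivity) (by positivity),
      Real.log_div (by positivity) (by positivity), Real.log_mul (by positivity) (by positivity),
      Real.log_pow, Real.log_pow, Real.log_pow]
    push_cast; ring
  · rw [Real.log_div (by positivity) (by positivity), Real.log_div (by positivity) (by positivity),
      Real.log_div (by positivity) (by positivity), Real.log_div (by positivity) (by positivity),
      Real.log_pow, Real.log_pow, Real.log_pow]
    push_cast; ring

lemma integral_fPiece : ∫ t, Real.log (fPiece t) ∂mu = ∫ t, phi t ∂mu := by
  have h1 : ∫ t, Real.log (fPiece t) ∂mu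
      = ∫ t, (phi t + Real.log (gg t) - Real.log (gg (T t))) ∂mu :=
    integral_congr_ae (by filter_upwards [mu_good] with x hx using log_fPiece hx)
  have h3 : Integrable (fun t => Real.log (gg (T t))) mu :=
    T_mp.integrable_comp_of_integrable (g := fun t => Real.log (gg t)) loggg_int
  have h2 : ∫ t, Real.log (gg (T t)) ∂mu = ∫ t, Real.log (gg t) ∂mu := by
    have := integral_map (μ := mu) (φ := T) T_measurable.aemeasurable
      (f := fun t => Real.log (gg t)) gg_measurable.log.aestronglyMeasurable
    rw [T_mp.map_eq] at this
    exact this.symm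
  rw [h1, integral_sub (f := fun t => phi t + Real.log (gg t)) (phi_int.add loggg_int) h3, integral_add phi_int loggg_int, h2]
  ring

/-- for Lebesgue-a.e. `x ∈ (0,1)`,
`(2 log Q_N(x))/N → ∫₀¹ log f dμ`. -/
theorem qn_growth_rate :
    ∀ᵐ x ∂(volume.restrict (Set.Ioo (0 : ℝ) 1)),
      Filter.Tendsto (fun N : ℕ => 2 * Real.log (Qc N x) / N) Filter.atTop
        (nhds (∫ t, Real.log (fPiece t) ∂mu)) := by
  rw [integral_fPiece]
  filter_upwards [ae_good, ac_mu.ae_le (birkhoff_ae T_ergodic phi_measurable phi_int)] with x hx hb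
  have hz : Tendsto (fun N : ℕ => (2 * Real.log (Qc N x) - birkhoffSum T phi N x) / N)
      atTop (𝓝 0) := by
    refine squeeze_zero_norm (fun N => ?_) (tendsto_const_div_atTop_nhds_zero_nat (4 : ℝ))
    rw [norm_div, Real.norm_eq_abs, Real.norm_natCast]
    exact div_le_div_of_nonneg_right (log_Q_close hx N) (Nat.cast_nonneg N)
  have := hz.add hb
  rw [zero_add] at this
  refine this.congr fun N => ?_
  ring

end SCF
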